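/- arXiv:1902.06577 — 3 statements merged into one kernel-verified Lean document; each statement's English description precedes it below -/
import Mathlib

section
/- In the polynomial ring K[x₁,…,x_{2n}], the minimal number of generators of the ideal I_{2n,n+1} = ⋂_{F ⊆ {1,…,2n}, #F = n+1} (xᵢ − xⱼ | i, j ∈ F) equals the n-th Catalan number C_n = (1/(2n+1))·binom(2n+1, n). Similarly, the ideal I_{2n−1,n+1} ⊆ K[x₁,…,x_{2n−1}] is minimally generated by C_n elements. -/
open MvPolynomial

/-- `T : Fin n → ℕ × ℕ` is a Young tableau of shape given by the list `parts` of row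
lengths: `T` is a bijection from `{0, …, n-1}` onto the set of boxes `(r, c)`
(row `r`, column `c`, both 0-indexed) of the Young diagram of `parts`. -/
def IsTableau (parts : List ℕ) {n : ℕ} (T : Fin n → ℕ × ℕ) : Prop :=
  Function.Injective T ∧
  (∀ i : Fin n, (T i).1 < parts.length ∧ (T i).2 < parts.getD (T i).1 0) ∧
  (∀ r c : ℕ, r < parts.length → c < parts.getD r 0 → ∃ i : Fin n, T i = (r, c))

/-- The Specht polynomial `f_T` of a tableau `T`: the product over all columns `j` of
`∏_{1 ≤ s < t ≤ m} (x_{j_s} - x_{j_t})`, where `j_1, …, j_m` are the entries of column `j`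
from top to bottom; equivalently, the product of `X i - X j` over all pairs of entries
`i, j` lying in the same column with `i` strictly above `j`. -/
noncomputable def spechtPoly (K : Type*) [CommRing K] {n : ℕ} (T : Fin n → ℕ × ℕ) :
    MvPolynomial (Fin n) K :=
  ∏ p ∈ Finset.univ.filter
      (fun p : Fin n × Fin n => (T p.1).2 = (T p.2).2 ∧ (T p.1).1 < (T p.2).1),
    (X p.1 - X p.2)

/-- The Specht ideal of shape `parts`: the ideal of `K[x_1, …, x_n]` generated by all
Specht polynomials of Young tableaux of shape `parts`. -/
noncomputable def spechtIdeal (K : Type*) [CommRing K] (n : ℕ) (parts : List ℕ) :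
    Ideal (MvPolynomial (Fin n) K) :=
  Ideal.span {f | ∃ T : Fin n → ℕ × ℕ, IsTableau parts T ∧ f = spechtPoly K T}

/-- The ideal `P_F = (x_i - x_j ∣ i, j ∈ F)`. -/
noncomputable def PFIdeal (K : Type*) [CommRing K] {n : ℕ} (F : Finset (Fin n)) :
    Ideal (MvPolynomial (Fin n) K) :=
  Ideal.span {f | ∃ i ∈ F, ∃ j ∈ F, f = X i - X j}

/-- The ideal `I_{n,k} = ⋂_{F ⊆ [n], #F = k} P_F`. -/
noncomputable def InkIdeal (K : Type*) [CommRing K] (n k : ℕ) :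
    Ideal (MvPolynomial (Fin n) K) :=
  ⨅ F ∈ {F : Finset (Fin n) | F.card = k}, PFIdeal K F

/-- The minimal number of generators of an ideal. -/
noncomputable def minNumGens {R : Type*} [CommRing R] (I : Ideal R) : ℕ :=
  sInf {k : ℕ | ∃ s : Finset R, s.card = k ∧ Ideal.span (s : Set R) = I}



section SubsetFunctions

variable {σ K : Type*} [DecidableEq σ] [Field K]

/-- The coefficient of the variable `a` in a multilinear form. -/
def varCoeff (K : Type*) [Field K] (a : σ) : (Finset σ → K) →ₗ[K] (Finset σ → K) where
  toFun w U := if a ∈ U then 0 else w (insert a U)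
  map_add' v w := by ext U; by_cases h : a ∈ U <;> simp [h]
  map_smul' c w := by ext U; by_cases h : a ∈ U <;> simp [h]

/-- Multiplication of a multilinear form by the variable `a`, which should not occur in it. -/
def mulVar (a : σ) (w : Finset σ → K) : Finset σ → K :=
  fun U => if a ∈ U then w (U.erase a) else 0

theorem mulVar_sub_comm (a b c d : σ) (hac : a ≠ c) (had : a ≠ d) (hbc : b ≠ c) (hbd : b ≠ d)
    (w : Finset σ → K) :
    mulVar a (mulVar c w - mulVar d w) - mulVar b (mulVar c w - mulVar d w) =
      mulVar c (mulVar a w - mulVar b w) - mulVar d (mulVar a w - mulVar b w) := by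
  ext U
  simp only [mulVar, Pi.sub_apply, Finset.mem_erase, Finset.erase_right_comm (a := c),
    Finset.erase_right_comm (a := d)]
  by_cases h1 : a ∈ U <;> by_cases h2 : b ∈ U <;> by_cases h3 : c ∈ U <;> by_cases h4 : d ∈ U <;>
    simp [h1, h2, h3, h4, hac, had, hbc, hbd, hac.symm, had.symm, hbc.symm, hbd.symm] <;> ring

/-- `IsMatching U w` says that `w` is the multilinear form `∏ (x a - x b)` over the pairs `{a, b}`
of a perfect matching of `U`. -/
inductive IsMatching : Finset σ → (Finset σ → K) → Prop
  | empty : IsMatching ∅ (Pi.single ∅ 1)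
  | insert {U : Finset σ} {w : Finset σ → K} {a b : σ} (h : IsMatching U w) (ha : a ∉ U)
      (hb : b ∉ U) (hab : a ≠ b) :
      IsMatching (insert a (insert b U)) (mulVar a w - mulVar b w)

theorem IsMatching.even {U : Finset σ} {w : Finset σ → K} (h : IsMatching U w) :
    ∃ k, U.card = 2 * k := by
  induction h with
  | empty => exact ⟨0, rfl⟩
  | @insert U w a b h ha hb hab ih =>
    obtain ⟨k, hk⟩ := ih
    refine ⟨k + 1, ?_⟩
    rw [Finset.card_insert_of_notMem (by simp [ha, hab]), Finset.card_insert_of_notMem hb, hk]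
    ring

/-- The span of the multilinear forms of the `k`-matchings in `A`. -/
def matchingSpan (K : Type*) [Field K] (A : Finset σ) (k : ℕ) : Submodule K (Finset σ → K) :=
  Submodule.span K {w | ∃ U ⊆ A, U.card = 2 * k ∧ IsMatching U w}

theorem matchingSpan_mono {A B : Finset σ} (h : A ⊆ B) (k : ℕ) :
    matchingSpan K A k ≤ matchingSpan K B k :=
  Submodule.span_mono fun _ ⟨U, hU, hw⟩ => ⟨U, hU.trans h, hw⟩

variable [Fintype σ]

/-- Functions `w` on the `k`-subsets of `A` for which the multilinear form `∑ U, w U ∏ i ∈ U, x i`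
is invariant under simultaneous translation of the variables. -/
def translationInvariant (K : Type*) [Field K] (A : Finset σ) (k : ℕ) :
    Submodule K (Finset σ → K) where
  carrier := {w | (∀ U, w U ≠ 0 → U ⊆ A ∧ U.card = k) ∧
    ∀ T : Finset σ, T.card < k → ∑ U with T ⊆ U, w U = 0}
  zero_mem' := ⟨fun U h => absurd rfl h, fun T _ => by simp⟩
  add_mem' := by
    rintro v w ⟨hv, hv'⟩ ⟨hw, hw'⟩
    refine ⟨fun U h => ?_, fun T hT => ?_⟩
    · by_cases h0 : v U = 0
      · exact hw U fun h1 => h (by simp [h0, h1])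
      · exact hv U h0
    · simp [Finset.sum_add_distrib, hv' T hT, hw' T hT]
  smul_mem' := by
    rintro c w ⟨hw, hw'⟩
    refine ⟨fun U h => hw U fun h0 => h (by simp [h0]), fun T hT => ?_⟩
    simp [← Finset.mul_sum, hw' T hT]

theorem sum_varCoeff {a : σ} {T : Finset σ} (ha : a ∉ T) (w : Finset σ → K) :
    ∑ U with T ⊆ U, varCoeff K a w U = ∑ U with insert a T ⊆ U, w U := by
  have h1 : ∑ U with T ⊆ U, varCoeff K a w U =
      ∑ U with T ⊆ U ∧ a ∉ U, w (insert a U) := by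
    rw [← Finset.filter_filter, Finset.sum_filter (fun U => a ∉ U)]
    refine Finset.sum_congr rfl fun U _ => ?_
    by_cases h : a ∈ U <;> simp [varCoeff, h]
  rw [h1]
  refine Finset.sum_nbij' (insert a) (fun U => U.erase a) ?_ ?_ ?_ ?_ ?_
  · intro U hU
    simp only [Finset.mem_filter, Finset.mem_univ, true_and] at hU ⊢
    exact Finset.insert_subset_insert _ hU.1
  · intro U hU
    simp only [Finset.mem_filter, Finset.mem_univ, true_and] at hU ⊢
    refine ⟨fun i hi => Finset.mem_erase.2 ⟨?_, hU (Finset.mem_insert_of_mem hi)⟩, by simp⟩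
    rintro rfl
    exact ha hi
  · intro U hU
    simp only [Finset.mem_filter, Finset.mem_univ, true_and] at hU
    exact Finset.erase_insert hU.2
  · intro U hU
    simp only [Finset.mem_filter, Finset.mem_univ, true_and] at hU
    exact Finset.insert_erase (hU (Finset.mem_insert_self _ _))
  · intro U _
    rfl

theorem sum_mulVar {a : σ} {w : Finset σ → K} (hw : ∀ U, a ∈ U → w U = 0) (T : Finset σ) :
    ∑ U with T ⊆ U, mulVar a w U = ∑ U with T.erase a ⊆ U, w U := by
  have h1 : ∑ U with T ⊆ U, mulVar a w U =
      ∑ U with T ⊆ U ∧ a ∈ U, w (U.erase a) := by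
    rw [← Finset.filter_filter, Finset.sum_filter (fun U => a ∈ U)]
    rfl
  have h2 : ∑ U with T.erase a ⊆ U, w U = ∑ U with T.erase a ⊆ U ∧ a ∉ U, w U := by
    rw [← Finset.filter_filter, Finset.sum_filter (fun U => a ∉ U)]
    refine Finset.sum_congr rfl fun U _ => ?_
    by_cases h : a ∈ U <;> simp [h, hw]
  rw [h1, h2]
  refine Finset.sum_nbij' (fun U => U.erase a) (insert a) ?_ ?_ ?_ ?_ ?_
  · intro U hU
    simp only [Finset.mem_filter, Finset.mem_univ, true_and] at hU ⊢
    exact ⟨Finset.erase_subset_erase _ hU.1, by simp⟩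
  · intro U hU
    simp only [Finset.mem_filter, Finset.mem_univ, true_and] at hU ⊢
    exact ⟨Finset.subset_insert_iff.2 hU.1, by simp⟩
  · intro U hU
    simp only [Finset.mem_filter, Finset.mem_univ, true_and] at hU
    exact Finset.insert_erase hU.2
  · intro U hU
    simp only [Finset.mem_filter, Finset.mem_univ, true_and] at hU
    exact Finset.erase_insert hU.2
  · intro U _
    rfl

theorem translationInvariant_mono {A B : Finset σ} (h : A ⊆ B) (k : ℕ) :
    translationInvariant K A k ≤ translationInvariant K B k :=
  fun _ hw => ⟨fun U hU => ⟨(hw.1 U hU).1.trans h, (hw.1 U hU).2⟩, hw.2⟩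

theorem eq_zero_of_notMem_of_mem {A : Finset σ} {k : ℕ} {w : Finset σ → K}
    (hw : w ∈ translationInvariant K A k) {a : σ} (ha : a ∉ A) {U : Finset σ} (hU : a ∈ U) :
    w U = 0 := by
  by_contra h
  exact ha ((hw.1 U h).1 hU)

theorem varCoeff_mem {A : Finset σ} {a : σ} (ha : a ∉ A) {k : ℕ} {w : Finset σ → K}
    (hw : w ∈ translationInvariant K (insert a A) (k + 1)) :
    varCoeff K a w ∈ translationInvariant K A k := by
  refine ⟨fun U hU => ?_, fun T hT => ?_⟩
  · by_cases haU : a ∈ U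
    · simp [varCoeff, haU] at hU
    · have := hw.1 (insert a U) (by simpa [varCoeff, haU] using hU)
      rw [Finset.card_insert_of_notMem haU] at this
      refine ⟨fun i hi => ?_, by omega⟩
      rcases Finset.mem_insert.1 (this.1 (Finset.mem_insert_of_mem hi)) with rfl | h
      · exact absurd hi haU
      · exact h
  · by_cases haT : a ∈ T
    · refine Finset.sum_eq_zero fun U hU => ?_
      simp [varCoeff, (Finset.mem_filter.1 hU).2 haT]
    · rw [sum_varCoeff haT]
      exact hw.2 _ (by rw [Finset.card_insert_of_notMem haT]; omega)

theorem mem_of_varCoeff_eq_zero {A : Finset σ} {a : σ} {k : ℕ} {w : Finset σ → K}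
    (hw : w ∈ translationInvariant K (insert a A) k) (h0 : varCoeff K a w = 0) :
    w ∈ translationInvariant K A k := by
  refine ⟨fun U hU => ⟨?_, (hw.1 U hU).2⟩, hw.2⟩
  have haU : a ∉ U := by
    intro haU
    apply hU
    have := congrFun h0 (U.erase a)
    simpa [varCoeff, Finset.insert_erase haU] using this
  exact (Finset.subset_insert_iff_of_notMem haU).1 (hw.1 U hU).1

theorem varCoeff_eq_zero_of_mem {A : Finset σ} {a : σ} (ha : a ∉ A) {k : ℕ} {w : Finset σ → K}
    (hw : w ∈ translationInvariant K A k) : varCoeff K a w = 0 := by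
  ext U
  by_cases haU : a ∈ U
  · simp [varCoeff, haU]
  · simp [varCoeff, haU, eq_zero_of_notMem_of_mem hw ha (Finset.mem_insert_self a U)]

theorem mulVar_sub_mulVar_mem {A : Finset σ} {a b : σ} (ha : a ∉ A) (hb : b ∉ A) (hab : a ≠ b)
    {k : ℕ} {w : Finset σ → K} (hw : w ∈ translationInvariant K A k) :
    mulVar a w - mulVar b w ∈ translationInvariant K (insert a (insert b A)) (k + 1) := by
  have key : ∀ c, c ∈ insert a (insert b A) → ∀ U, mulVar c w U ≠ 0 →
      U ⊆ insert a (insert b A) ∧ U.card = k + 1 := by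
    intro c hc U hU
    by_cases hcU : c ∈ U
    · have h := hw.1 (U.erase c) (by simpa [mulVar, hcU] using hU)
      rw [Finset.card_erase_of_mem hcU] at h
      have := Finset.card_pos.2 ⟨c, hcU⟩
      refine ⟨fun i hi => ?_, by omega⟩
      by_cases hic : i = c
      · exact hic ▸ hc
      · have := h.1 (Finset.mem_erase.2 ⟨hic, hi⟩)
        simp [this]
    · simp [mulVar, hcU] at hU
  refine ⟨fun U hU => ?_, fun T hT => ?_⟩
  · by_cases h : mulVar a w U = 0
    · exact key b (by simp) U fun h' => hU (by simp [h, h'])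
    · exact key a (by simp) U h
  · have hwa : ∀ U, a ∈ U → w U = 0 := fun U => eq_zero_of_notMem_of_mem hw ha
    have hwb : ∀ U, b ∈ U → w U = 0 := fun U => eq_zero_of_notMem_of_mem hw hb
    have hs : ∀ c d, c ≠ d → (∀ U, c ∈ U → w U = 0) → c ∈ T →
        ∑ U with T.erase d ⊆ U, w U = 0 := by
      intro c d hcd hc hcT
      refine Finset.sum_eq_zero fun U hU => hc U ?_
      exact (Finset.mem_filter.1 hU).2 (Finset.mem_erase.2 ⟨hcd, hcT⟩)
    have he : ∀ c, c ∈ T → ∑ U with T.erase c ⊆ U, w U = 0 := by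
      intro c hc
      have := Finset.card_pos.2 ⟨c, hc⟩
      exact hw.2 _ (by rw [Finset.card_erase_of_mem hc]; omega)
    simp only [Pi.sub_apply, Finset.sum_sub_distrib, sum_mulVar hwa, sum_mulVar hwb]
    by_cases haT : a ∈ T
    · rw [he a haT, hs a b hab hwa haT, sub_zero]
    · by_cases hbT : b ∈ T
      · rw [he b hbT, hs b a hab.symm hwb hbT, sub_zero]
      · rw [Finset.erase_eq_of_notMem haT, Finset.erase_eq_of_notMem hbT, sub_self]

theorem eq_zero_of_card_lt {A : Finset σ} {k : ℕ} (hA : A.card < 2 * k) {w : Finset σ → K}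
    (hw : w ∈ translationInvariant K A k) : w = 0 := by
  ext S
  by_contra hS
  obtain ⟨hSA, hSk⟩ := hw.1 S hS
  have h1 : ∑ T ∈ S.powerset, (-1 : K) ^ T.card * ∑ U with T ⊆ U, w U = (-1) ^ k * w S := by
    rw [Finset.sum_eq_single S]
    · rw [Finset.sum_eq_single S, hSk]
      · intro U hU hUS
        by_contra h
        have := Finset.eq_of_subset_of_card_le (Finset.mem_filter.1 hU).2
          (by rw [hSk, (hw.1 U h).2])
        exact hUS this.symm
      · simp
    · intro T hT hTS
      rw [hw.2 T, mul_zero]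
      rw [← hSk]
      exact Finset.card_lt_card ((Finset.mem_powerset.1 hT).ssubset_of_ne hTS)
    · simp
  have h2 : ∑ T ∈ S.powerset, (-1 : K) ^ T.card * ∑ U with T ⊆ U, w U = 0 := by
    simp_rw [Finset.sum_filter, Finset.mul_sum]
    rw [Finset.sum_comm]
    refine Finset.sum_eq_zero fun U _ => ?_
    by_cases hU : w U = 0
    · simp [hU]
    · obtain ⟨hUA, hUk⟩ := hw.1 U hU
      have hne : S ∩ U ≠ ∅ := by
        intro h
        have := Finset.card_union_of_disjoint (Finset.disjoint_iff_inter_eq_empty.2 h)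
        have := Finset.card_le_card (Finset.union_subset hSA hUA)
        omega
      have h3 := congrArg (Int.cast : ℤ → K) (Finset.sum_powerset_neg_one_pow_card (x := S ∩ U))
      rw [if_neg hne] at h3
      push_cast at h3
      have h4 : (S ∩ U).powerset = S.powerset.filter (fun T => T ⊆ U) := by
        ext T
        simp only [Finset.mem_powerset, Finset.mem_filter, Finset.subset_inter_iff]
      rw [h4, Finset.sum_filter] at h3
      calc _ = (∑ T ∈ S.powerset, if T ⊆ U then (-1 : K) ^ T.card else 0) * w U := by
            rw [Finset.sum_mul]
            refine Finset.sum_congr rfl fun T _ => ?_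
            split_ifs <;> simp
        _ = 0 := by rw [h3, zero_mul]
  rw [h1] at h2
  exact hS ((mul_eq_zero.1 h2).resolve_left (pow_ne_zero _ (by simp)))

theorem IsMatching.mem {U : Finset σ} {w : Finset σ → K} (h : IsMatching U w) :
    ∀ k, U.card = 2 * k → w ∈ translationInvariant K U k := by
  induction h with
  | empty =>
    intro k hk
    obtain rfl : k = 0 := by simpa using hk.symm
    refine ⟨fun U hU => ?_, by simp⟩
    by_cases h : U = ∅
    · simp [h]
    · simp [h] at hU
  | @insert U w a b h ha hb hab ih =>
    intro k hk
    rw [Finset.card_insert_of_notMem (by simp [ha, hab]), Finset.card_insert_of_notMem hb] at hk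
    obtain ⟨k, rfl⟩ : ∃ l, k = l + 1 := ⟨k - 1, by omega⟩
    exact mulVar_sub_mulVar_mem ha hb hab (ih k (by omega))

theorem IsMatching.eq_zero {U : Finset σ} {w : Finset σ → K} (h : IsMatching U w) {a : σ}
    (ha : a ∉ U) {S : Finset σ} (haS : a ∈ S) : w S = 0 := by
  obtain ⟨k, hk⟩ := h.even
  exact eq_zero_of_notMem_of_mem (h.mem k hk) ha haS

theorem varCoeff_mulVar_sub {A : Finset σ} {w : Finset σ → K} (h : IsMatching A w) {a b : σ}
    (ha : a ∉ A) (hab : a ≠ b) :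
    varCoeff K a (mulVar a w - mulVar b w) = w := by
  ext U
  by_cases haU : a ∈ U
  · simp [varCoeff, haU, h.eq_zero ha haU]
  · by_cases hbU : b ∈ U
    · have h1 : w ((insert a U).erase b) = 0 :=
        h.eq_zero ha (Finset.mem_erase.2 ⟨hab, Finset.mem_insert_self _ _⟩)
      simp [varCoeff, haU, mulVar, hbU, h1]
    · simp [varCoeff, haU, mulVar, hbU, hab.symm]

theorem matchingSpan_le (A : Finset σ) (k : ℕ) :
    matchingSpan K A k ≤ translationInvariant K A k :=
  Submodule.span_le.2 fun _ ⟨_, hU, hk, hw⟩ => translationInvariant_mono hU k (hw.mem k hk)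

theorem eq_smul_single {A : Finset σ} {w : Finset σ → K} (hw : w ∈ translationInvariant K A 0) :
    w = w ∅ • Pi.single ∅ 1 := by
  ext U
  by_cases hU : U = ∅
  · simp [hU]
  · by_cases h : w U = 0
    · simp [hU, h]
    · exact absurd (Finset.card_eq_zero.1 (hw.1 U h).2) hU

theorem matchingSpan_le_map {A : Finset σ} {a : σ} (ha : a ∉ A) {k : ℕ} (hk : 2 * k < A.card) :
    matchingSpan K A k ≤ (matchingSpan K (insert a A) (k + 1)).map (varCoeff K a) := by
  refine Submodule.span_le.2 ?_
  rintro w ⟨U, hU, hUk, hw⟩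
  obtain ⟨b, hbA, hbU⟩ := Finset.exists_mem_notMem_of_card_lt_card (hUk ▸ hk)
  have haU : a ∉ U := fun h => ha (hU h)
  have hab : a ≠ b := fun h => ha (h ▸ hbA)
  refine ⟨mulVar a w - mulVar b w, Submodule.subset_span ⟨_, ?_, ?_, hw.insert haU hbU hab⟩,
    varCoeff_mulVar_sub hw haU hab⟩
  · exact Finset.insert_subset_insert _ (Finset.insert_subset hbA hU)
  · rw [Finset.card_insert_of_notMem (by simp [haU, hab]), Finset.card_insert_of_notMem hbU, hUk]
    ring

theorem le_matchingSpan (A : Finset σ) :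
    ∀ k, 2 * k ≤ A.card → translationInvariant K A k ≤ matchingSpan K A k := by
  induction A using Finset.induction_on with
  | empty =>
    intro k hk w hw
    obtain rfl : k = 0 := by simpa using hk
    rw [eq_smul_single hw]
    exact Submodule.smul_mem _ _ (Submodule.subset_span ⟨∅, by simp, rfl, .empty⟩)
  | insert a A ha ih =>
    intro k hk w hw
    rw [Finset.card_insert_of_notMem ha] at hk
    cases k with
    | zero =>
      rw [eq_smul_single hw]
      exact Submodule.smul_mem _ _ (Submodule.subset_span ⟨∅, by simp, rfl, .empty⟩)
    | succ k =>
      obtain ⟨v, hv, hvw⟩ := matchingSpan_le_map ha (by omega)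
        (ih k (by omega) (varCoeff_mem ha hw))
      have hd : w - v ∈ translationInvariant K A (k + 1) :=
        mem_of_varCoeff_eq_zero (Submodule.sub_mem _ hw (matchingSpan_le _ _ hv))
          (by rw [map_sub, hvw, sub_self])
      have hd' : w - v ∈ matchingSpan K (insert a A) (k + 1) := by
        by_cases h : 2 * (k + 1) ≤ A.card
        · exact matchingSpan_mono (Finset.subset_insert _ _) _ (ih _ h hd)
        · rw [eq_zero_of_card_lt (by omega) hd]
          exact Submodule.zero_mem _
      simpa using Submodule.add_mem _ hd' hv

theorem translationInvariant_eq_matchingSpan {A : Finset σ} {k : ℕ} (hk : 2 * k ≤ A.card) :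
    translationInvariant K A k = matchingSpan K A k :=
  le_antisymm (le_matchingSpan A k hk) (matchingSpan_le A k)

/-- The span of the multilinear forms of those `k`-matchings in `A` that miss an element of `E`
or contain a pair of elements of `E`. -/
def matchingSpanIn (K : Type*) [Field K] (A : Finset σ) (k : ℕ) (E : Finset σ) :
    Submodule K (Finset σ → K) :=
  Submodule.span K ({w | ∃ U ⊆ A, U.card = 2 * k ∧ IsMatching U w ∧ ¬ E ⊆ U} ∪
    {w | ∃ U v s t, IsMatching U v ∧ s ∉ U ∧ t ∉ U ∧ s ≠ t ∧ s ∈ E ∧ t ∈ E ∧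
      insert s (insert t U) ⊆ A ∧ (insert s (insert t U)).card = 2 * k ∧
      w = mulVar s v - mulVar t v})

theorem matchingSpanIn_le_map {A E : Finset σ} {a : σ} (ha : a ∉ A) (hE : E ⊆ A) {k : ℕ}
    (hk : 2 * k < A.card) : matchingSpanIn K A k E ≤
      (matchingSpan K (insert a A) (k + 1) ⊓ matchingSpanIn K (insert a A) (k + 1) (insert a E)).map
        (varCoeff K a) := by
  refine Submodule.span_le.2 ?_
  have hcard : ∀ U ⊆ A, ∀ b ∈ A, b ∉ U → U.card = 2 * k →
      (insert a (insert b U)).card = 2 * (k + 1) := by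
    intro U hU b hbA hbU hUk
    rw [Finset.card_insert_of_notMem, Finset.card_insert_of_notMem hbU, hUk]
    · ring
    · rw [Finset.mem_insert, not_or]
      exact ⟨fun h => ha (h ▸ hbA), fun h => ha (hU h)⟩
  rintro w (⟨U, hU, hUk, hw, hEU⟩ | ⟨U, v, s, t, hv, hs, ht, hst, hsE, htE, hU, hUk, rfl⟩)
  · obtain ⟨b, hbE, hbU⟩ := Finset.not_subset.1 hEU
    have haU : a ∉ U := fun h => ha (hU h)
    have hab : a ≠ b := fun h => ha (h ▸ hE hbE)
    have hsub := Finset.insert_subset_insert a (Finset.insert_subset (hE hbE) hU)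
    have hc := hcard U hU b (hE hbE) hbU hUk
    refine ⟨mulVar a w - mulVar b w, ⟨Submodule.subset_span
      ⟨_, hsub, hc, hw.insert haU hbU hab⟩, Submodule.subset_span (Or.inr
      ⟨U, w, a, b, hw, haU, hbU, hab, by simp, by simp [hbE], hsub, hc, rfl⟩)⟩,
      varCoeff_mulVar_sub hw haU hab⟩
  · obtain ⟨b, hbA, hbU⟩ := Finset.exists_mem_notMem_of_card_lt_card (hUk ▸ hk)
    have haU : a ∉ insert s (insert t U) := fun h => ha (hU h)
    have hab : a ≠ b := fun h => ha (h ▸ hbA)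
    have hsub := Finset.insert_subset_insert a (Finset.insert_subset hbA hU)
    have hc := hcard _ hU b hbA hbU hUk
    have hw := hv.insert hs ht hst
    have hcomm : insert a (insert b (insert s (insert t U))) =
        insert s (insert t (insert a (insert b U))) := by
      ext; simp only [Finset.mem_insert]; tauto
    refine ⟨mulVar a (mulVar s v - mulVar t v) - mulVar b (mulVar s v - mulVar t v),
      ⟨Submodule.subset_span ⟨_, hsub, hc, hw.insert haU hbU hab⟩,
      Submodule.subset_span (Or.inr
      ⟨insert a (insert b U), mulVar a v - mulVar b v, s, t, ?_, ?_, ?_, hst, by simp [hsE],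
        by simp [htE], hcomm ▸ hsub, hcomm ▸ hc, ?_⟩)⟩, varCoeff_mulVar_sub hw haU hab⟩
    all_goals simp only [Finset.mem_insert, not_or] at haU hbU
    · exact hv.insert haU.2.2 hbU.2.2 hab
    · simp only [Finset.mem_insert, not_or]
      exact ⟨Ne.symm haU.1, Ne.symm hbU.1, hs⟩
    · simp only [Finset.mem_insert, not_or]
      exact ⟨Ne.symm haU.2.1, Ne.symm hbU.2.1, ht⟩
    · exact mulVar_sub_comm _ _ _ _ haU.1 haU.2.1 hbU.1 hbU.2.1 _

theorem mem_matchingSpanIn (E : Finset σ) :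
    ∀ (A : Finset σ) (k : ℕ) (w : Finset σ → K), E ⊆ A → 2 * k ≤ A.card →
      w ∈ translationInvariant K A k → (∀ U, E ⊆ U → w U = 0) → w ∈ matchingSpanIn K A k E := by
  induction E using Finset.induction_on with
  | empty =>
    intro A k w _ _ _ h0
    obtain rfl : w = 0 := funext fun U => h0 U (by simp)
    exact Submodule.zero_mem _
  | insert a E haE ih =>
    intro A k w hEA hk hw h0
    obtain ⟨A, ha, rfl⟩ : ∃ B, a ∉ B ∧ A = insert a B :=
      ⟨A.erase a, by simp, (Finset.insert_erase (hEA (Finset.mem_insert_self _ _))).symm⟩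
    rw [Finset.card_insert_of_notMem ha] at hk
    have hEA' : E ⊆ A := fun i hi => by
      rcases Finset.mem_insert.1 (hEA (Finset.mem_insert_of_mem hi)) with rfl | h
      · exact absurd hi haE
      · exact h
    have hmiss : ∀ l, matchingSpan K A l ≤ matchingSpanIn K (insert a A) l (insert a E) := by
      refine fun l => Submodule.span_mono fun v hv => Or.inl ?_
      obtain ⟨U, hU, hUk, hv⟩ := hv
      exact ⟨U, hU.trans (Finset.subset_insert _ _), hUk, hv,
        fun h => ha (hU (h (Finset.mem_insert_self _ _)))⟩
    cases k with
    | zero =>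
      rw [eq_smul_single hw]
      exact Submodule.smul_mem _ _ (hmiss 0 (Submodule.subset_span ⟨∅, by simp, rfl, .empty⟩))
    | succ k =>
      have hz : ∀ U, E ⊆ U → varCoeff K a w U = 0 := by
        intro U hU
        by_cases haU : a ∈ U
        · simp [varCoeff, haU]
        · simpa [varCoeff, haU] using h0 _ (Finset.insert_subset_insert a hU)
      obtain ⟨v, ⟨hv1, hv2⟩, hvw⟩ := matchingSpanIn_le_map ha hEA' (by omega)
        (ih A k _ hEA' (by omega) (varCoeff_mem ha hw) hz)
      have hd : w - v ∈ translationInvariant K A (k + 1) :=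
        mem_of_varCoeff_eq_zero (Submodule.sub_mem _ hw (matchingSpan_le _ _ hv1))
          (by rw [map_sub, hvw, sub_self])
      have hd' : w - v ∈ matchingSpanIn K (insert a A) (k + 1) (insert a E) := by
        by_cases h : 2 * (k + 1) ≤ A.card
        · exact hmiss _ (le_matchingSpan _ _ h hd)
        · rw [eq_zero_of_card_lt (by omega) hd]
          exact Submodule.zero_mem _
      simpa using Submodule.add_mem _ hd' hv2

theorem finrank_translationInvariant_zero (A : Finset σ) :
    Module.finrank K (translationInvariant K A 0) = 1 := by
  have : translationInvariant K A 0 = Submodule.span K {Pi.single ∅ 1} := by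
    refine le_antisymm (fun w hw => ?_) ?_
    · rw [eq_smul_single hw]
      exact Submodule.smul_mem _ _ (Submodule.mem_span_singleton_self _)
    · rw [Submodule.span_singleton_le_iff_mem]
      exact translationInvariant_mono (Finset.empty_subset A) 0 (IsMatching.empty.mem 0 rfl)
  rw [this]
  exact finrank_span_singleton (by simp)

theorem finrank_translationInvariant_insert {A : Finset σ} {a : σ} (ha : a ∉ A) {k : ℕ}
    (hk : 2 * k < A.card) :
    Module.finrank K (translationInvariant K (insert a A) (k + 1)) =
      Module.finrank K (translationInvariant K A k) +
        Module.finrank K (translationInvariant K A (k + 1)) := by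
  set W := translationInvariant K (insert a A) (k + 1) with hW
  have h1 : LinearMap.range ((varCoeff K a).domRestrict W) = translationInvariant K A k := by
    rw [LinearMap.range_domRestrict]
    refine le_antisymm ?_ ?_
    · rintro _ ⟨w, hw, rfl⟩
      exact varCoeff_mem ha hw
    · exact (le_matchingSpan A k hk.le).trans
        ((matchingSpan_le_map ha hk).trans (Submodule.map_mono (matchingSpan_le _ _)))
  have h2 : (LinearMap.ker ((varCoeff K a).domRestrict W)).map W.subtype =
      translationInvariant K A (k + 1) := by
    ext w
    simp only [Submodule.mem_map, LinearMap.mem_ker, LinearMap.domRestrict_apply,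
      Submodule.subtype_apply, Subtype.exists, exists_and_left, exists_prop, exists_eq_right_right]
    exact ⟨fun h => mem_of_varCoeff_eq_zero h.2 h.1, fun h => ⟨varCoeff_eq_zero_of_mem ha h,
      translationInvariant_mono (Finset.subset_insert _ _) _ h⟩⟩
  have h3 := LinearMap.finrank_range_add_finrank_ker ((varCoeff K a).domRestrict W)
  rw [h1] at h3
  rw [← h3, ← h2, LinearEquiv.finrank_eq (Submodule.equivSubtypeMap _ _)]

theorem finrank_translationInvariant_succ (A : Finset σ) :
    ∀ k, 2 * k + 1 ≤ A.card →
      Module.finrank K (translationInvariant K A (k + 1)) + A.card.choose k =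
        A.card.choose (k + 1) := by
  induction A using Finset.induction_on with
  | empty => intro k hk; simp at hk
  | insert a A ha ih =>
    intro k hk
    rw [Finset.card_insert_of_notMem ha] at hk ⊢
    rcases eq_or_lt_of_le hk with h | h
    · have h0 : translationInvariant K (insert a A) (k + 1) = ⊥ := by
        rw [eq_bot_iff]
        intro w hw
        rw [eq_zero_of_card_lt (by rw [Finset.card_insert_of_notMem ha]; omega) hw]
        exact Submodule.zero_mem _
      rw [h0, finrank_bot, zero_add]
      exact Nat.choose_symm_of_eq_add (by omega)
    · rw [finrank_translationInvariant_insert ha (by omega), Nat.choose_succ_succ' A.card k,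
        ← ih k (by omega)]
      cases k with
      | zero => simp [finrank_translationInvariant_zero]; ring
      | succ k =>
        have := ih k (by omega)
        rw [Nat.choose_succ_succ' A.card k]
        omega

end SubsetFunctions

section Polynomials

variable {σ K : Type*} [Field K]

variable [DecidableEq σ]

/-- The exponent vector of the squarefree monomial `∏ i ∈ U, x i`. -/
noncomputable def sqfreeExponent (U : Finset σ) : σ →₀ ℕ :=
  Finsupp.indicator U fun _ _ => 1

theorem sqfreeExponent_apply (U : Finset σ) (i : σ) :
    sqfreeExponent U i = if i ∈ U then 1 else 0 := by
  simp [sqfreeExponent, Finsupp.indicator_apply]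

theorem sqfreeExponent_injective : Function.Injective (sqfreeExponent (σ := σ)) := by
  intro U V h
  ext i
  have := DFunLike.congr_fun h i
  simp only [sqfreeExponent_apply] at this
  by_cases h1 : i ∈ U <;> by_cases h2 : i ∈ V <;> simp_all

theorem degree_sqfreeExponent (U : Finset σ) : (sqfreeExponent U).degree = U.card := by
  have hs : (sqfreeExponent U).support = U := by
    ext i
    simp [sqfreeExponent_apply]
  rw [Finsupp.degree_apply, hs, Finset.card_eq_sum_ones]
  exact Finset.sum_congr rfl fun i hi => by simp [sqfreeExponent_apply, hi]

/-- The substitution `x a ↦ x s`. -/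
noncomputable def substVar (K : Type*) [Field K] (a s : σ) :
    MvPolynomial σ K →ₐ[K] MvPolynomial σ K :=
  aeval fun i => if i = a then X s else X i

theorem substVar_X (a s i : σ) :
    substVar K a s (X i) = if i = a then X s else X i := by
  simp [substVar]

theorem substVar_substVar {a s : σ} (h : s ≠ a) (t : σ) (f : MvPolynomial σ K) :
    substVar K a t (substVar K a s f) = substVar K a s f := by
  have : (substVar K a t).comp (substVar K a s) = substVar K a s := by
    refine algHom_ext fun i => ?_
    rw [AlgHom.comp_apply, substVar_X]
    split_ifs with hi
    · rw [substVar_X, if_neg h]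
    · rw [substVar_X, if_neg hi]
  exact DFunLike.congr_fun this f

theorem sub_substVar_mem (a s : σ) (f : MvPolynomial σ K) :
    f - substVar K a s f ∈ Ideal.span {(X a - X s : MvPolynomial σ K)} := by
  induction f using MvPolynomial.induction_on with
  | C c => simp [substVar]
  | add p q hp hq =>
    rw [map_add, add_sub_add_comm]
    exact Submodule.add_mem _ hp hq
  | mul_X p i hp =>
    rw [map_mul, substVar_X]
    split_ifs with hi
    · subst hi
      have : p * X i - substVar K i s p * X s =
          X i * (p - substVar K i s p) + substVar K i s p * (X i - X s) := by ring
      rw [this]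
      exact Submodule.add_mem _ (Ideal.mul_mem_left _ _ hp)
        (Ideal.mul_mem_left _ _ (Ideal.mem_span_singleton_self _))
    · rw [← sub_mul]
      exact Ideal.mul_mem_right _ _ hp

/-- The substitution `x i ↦ x i + c * x y` for all `i ≠ y`. -/
noncomputable def shiftVars (y : σ) (c : K) : MvPolynomial σ K →ₐ[K] MvPolynomial σ K :=
  aeval fun i => if i = y then X i else X i + C c * X y

theorem shiftVars_X (y : σ) (c : K) (i : σ) :
    shiftVars y c (X i) = if i = y then X i else X i + C c * X y := by
  simp [shiftVars]

theorem shiftVars_neg_shiftVars (y : σ) (c : K) (f : MvPolynomial σ K) :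
    shiftVars y (-c) (shiftVars y c f) = f := by
  have : (shiftVars y (-c)).comp (shiftVars y c) = AlgHom.id K _ := by
    refine algHom_ext fun i => ?_
    rw [AlgHom.comp_apply, shiftVars_X]
    split_ifs with hi
    · rw [shiftVars_X, if_pos hi, AlgHom.id_apply]
    · simp only [map_add, map_mul, shiftVars_X, if_neg hi, if_true, algHom_C, algebraMap_eq,
        AlgHom.id_apply, map_neg]
      ring
  exact DFunLike.congr_fun this f

variable [Fintype σ]

/-- The multilinear polynomial with a given family of coefficients. -/
noncomputable def multilinearPoly : (Finset σ → K) →ₗ[K] MvPolynomial σ K :=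
  ∑ U, (monomial (sqfreeExponent U)) ∘ₗ LinearMap.proj U

omit [DecidableEq σ] in
theorem multilinearPoly_apply (w : Finset σ → K) :
    multilinearPoly w = ∑ U, monomial (sqfreeExponent U) (w U) := by
  simp [multilinearPoly, LinearMap.sum_apply]

theorem coeff_multilinearPoly (w : Finset σ → K) (U : Finset σ) :
    coeff (sqfreeExponent U) (multilinearPoly w) = w U := by
  simp [multilinearPoly_apply, coeff_sum, coeff_monomial, sqfreeExponent_injective.eq_iff]

theorem exists_of_coeff_multilinearPoly_ne_zero {w : Finset σ → K} {m : σ →₀ ℕ}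
    (h : coeff m (multilinearPoly w) ≠ 0) : ∃ U, m = sqfreeExponent U ∧ w U ≠ 0 := by
  rw [multilinearPoly_apply, coeff_sum] at h
  obtain ⟨U, -, hU⟩ := Finset.exists_ne_zero_of_sum_ne_zero h
  rw [coeff_monomial] at hU
  split_ifs at hU with h'
  · exact ⟨U, h'.symm, hU⟩
  · exact absurd rfl hU

theorem multilinearPoly_mulVar {a : σ} {w : Finset σ → K} (hw : ∀ U, a ∈ U → w U = 0) :
    multilinearPoly (mulVar a w) = X a * multilinearPoly w := by
  have h1 : multilinearPoly (mulVar a w) =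
      ∑ U with a ∈ U, monomial (sqfreeExponent U) (w (U.erase a)) := by
    rw [multilinearPoly_apply, Finset.sum_filter]
    refine Finset.sum_congr rfl fun U _ => ?_
    by_cases h : a ∈ U <;> simp [mulVar, h]
  have h2 : X a * multilinearPoly w =
      ∑ U with a ∉ U, monomial (sqfreeExponent (insert a U)) (w U) := by
    rw [multilinearPoly_apply, Finset.mul_sum, Finset.sum_filter]
    refine Finset.sum_congr rfl fun U _ => ?_
    by_cases h : a ∈ U
    · simp [hw U h, h]
    · rw [if_pos h, X, monomial_mul, one_mul]
      congr 2
      ext i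
      simp only [Finsupp.add_apply, sqfreeExponent_apply, Finsupp.single_apply, Finset.mem_insert]
      by_cases hi : a = i
      · subst hi; simp [h]
      · simp [hi, Ne.symm hi]
  rw [h1, h2]
  refine Finset.sum_nbij' (fun U => U.erase a) (insert a) ?_ ?_ ?_ ?_ ?_
  · intro U _
    simp
  · intro U _
    simp
  · intro U hU
    exact Finset.insert_erase (Finset.mem_filter.1 hU).2
  · intro U hU
    exact Finset.erase_insert (Finset.mem_filter.1 hU).2
  · intro U hU
    rw [Finset.insert_erase (Finset.mem_filter.1 hU).2]

theorem IsMatching.multilinearPoly_insert {U : Finset σ} {w : Finset σ → K} (h : IsMatching U w)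
    {a b : σ} (ha : a ∉ U) (hb : b ∉ U) :
    multilinearPoly (mulVar a w - mulVar b w) = (X a - X b) * multilinearPoly w := by
  rw [map_sub, multilinearPoly_mulVar fun S hS => h.eq_zero ha hS,
    multilinearPoly_mulVar fun S hS => h.eq_zero hb hS, sub_mul]

theorem multilinearPoly_empty : multilinearPoly (Pi.single ∅ 1 : Finset σ → K) = 1 := by
  rw [multilinearPoly_apply, Finset.sum_eq_single ∅]
  · have : sqfreeExponent (∅ : Finset σ) = 0 := by ext; simp [sqfreeExponent_apply]
    simp [this]
  · intro U _ hU
    simp [hU]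
  · simp

/-- An algebra endomorphism preserving the differences of the variables in `U` fixes the
polynomial of every perfect matching of `U`. -/
theorem IsMatching.map_eq {U : Finset σ} {w : Finset σ → K} (h : IsMatching U w)
    (φ : MvPolynomial σ K →ₐ[K] MvPolynomial σ K)
    (hφ : ∀ i ∈ U, ∀ j ∈ U, φ (X i) - φ (X j) = X i - X j) :
    φ (multilinearPoly w) = multilinearPoly w := by
  induction h with
  | empty => rw [multilinearPoly_empty, map_one]
  | @insert U w a b h ha hb hab ih =>
    rw [h.multilinearPoly_insert ha hb, map_mul, map_sub, hφ a (by simp) b (by simp),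
      ih fun i hi j hj => hφ i (by simp [hi]) j (by simp [hj])]

/-- The ideal generated by the polynomials of the `k`-matchings in `A`. -/
noncomputable def matchingIdeal (K : Type*) [Field K] (A : Finset σ) (k : ℕ) :
    Ideal (MvPolynomial σ K) :=
  Ideal.span {f | ∃ U ⊆ A, U.card = 2 * k ∧ ∃ w, IsMatching U w ∧ f = multilinearPoly w}

theorem matchingIdeal_mono {A B : Finset σ} (h : A ⊆ B) (k : ℕ) :
    matchingIdeal K A k ≤ matchingIdeal K B k :=
  Ideal.span_mono fun _ ⟨U, hU, hw⟩ => ⟨U, hU.trans h, hw⟩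

theorem matchingIdeal_zero (A : Finset σ) : matchingIdeal K A 0 = ⊤ :=
  (Ideal.eq_top_iff_one _).2 (Ideal.subset_span
    ⟨∅, by simp, rfl, _, .empty, multilinearPoly_empty.symm⟩)

theorem IsMatching.mem_matchingIdeal {U A : Finset σ} {w : Finset σ → K} (h : IsMatching U w)
    (hU : U ⊆ A) {k : ℕ} (hk : U.card = 2 * k) : multilinearPoly w ∈ matchingIdeal K A k :=
  Ideal.subset_span ⟨U, hU, hk, w, h, rfl⟩

theorem IsMatching.sub_mul_mem_matchingIdeal {U A : Finset σ} {w : Finset σ → K}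
    (h : IsMatching U w) {a b : σ} (ha : a ∉ U) (hb : b ∉ U) (hab : a ≠ b) (haA : a ∈ A)
    (hbA : b ∈ A) (hU : U ⊆ A) {k : ℕ} (hk : U.card = 2 * k) :
    (X a - X b) * multilinearPoly w ∈ matchingIdeal K A (k + 1) := by
  rw [← h.multilinearPoly_insert ha hb]
  refine (h.insert ha hb hab).mem_matchingIdeal
    (Finset.insert_subset haA (Finset.insert_subset hbA hU)) ?_
  rw [Finset.card_insert_of_notMem (by simp [ha, hab]), Finset.card_insert_of_notMem hb, hk]
  ring

theorem matchingIdeal_eq_span_image (A : Finset σ) (k : ℕ) :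
    matchingIdeal K A k = Ideal.span (multilinearPoly '' (matchingSpan K A k : Set _)) := by
  refine le_antisymm (Ideal.span_mono ?_) (Ideal.span_le.2 ?_)
  · rintro _ ⟨U, hU, hk, w, hw, rfl⟩
    exact ⟨w, Submodule.subset_span ⟨U, hU, hk, hw⟩, rfl⟩
  · have : matchingSpan K A k ≤
        ((matchingIdeal K A k).restrictScalars K).comap multilinearPoly :=
      Submodule.span_le.2 fun w ⟨U, hU, hk, hw⟩ => hw.mem_matchingIdeal hU hk
    rintro _ ⟨w, hw, rfl⟩
    exact this hw

theorem exists_finsupp_of_mem_matchingIdeal {A : Finset σ} {k : ℕ} {g : MvPolynomial σ K}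
    (hg : g ∈ matchingIdeal K A k) : ∃ v : (σ →₀ ℕ) →₀ (Finset σ → K),
      (∀ e, v e ∈ matchingSpan K A k) ∧
        g = v.sum fun e w => monomial e 1 * multilinearPoly w := by
  suffices H : ∀ r : MvPolynomial σ K, ∃ v : (σ →₀ ℕ) →₀ (Finset σ → K),
      (∀ e, v e ∈ matchingSpan K A k) ∧
        r * g = v.sum fun e w => monomial e 1 * multilinearPoly w by
    simpa using H 1
  have hadd : ∀ f₁ f₂ : MvPolynomial σ K,
      (∃ v : (σ →₀ ℕ) →₀ (Finset σ → K), (∀ e, v e ∈ matchingSpan K A k) ∧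
        f₁ = v.sum fun e w => monomial e 1 * multilinearPoly w) →
      (∃ v : (σ →₀ ℕ) →₀ (Finset σ → K), (∀ e, v e ∈ matchingSpan K A k) ∧
        f₂ = v.sum fun e w => monomial e 1 * multilinearPoly w) →
      ∃ v : (σ →₀ ℕ) →₀ (Finset σ → K), (∀ e, v e ∈ matchingSpan K A k) ∧
        f₁ + f₂ = v.sum fun e w => monomial e 1 * multilinearPoly w := by
    rintro _ _ ⟨v₁, h₁, rfl⟩ ⟨v₂, h₂, rfl⟩
    refine ⟨v₁ + v₂, fun e => Submodule.add_mem _ (h₁ e) (h₂ e), ?_⟩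
    rw [Finsupp.sum_add_index']
    · simp
    · simp [mul_add]
  induction hg using Submodule.span_induction with
  | mem g hg =>
    obtain ⟨U, hU, hk, w, hw, rfl⟩ := hg
    intro r
    induction r using MvPolynomial.induction_on' with
    | monomial e c =>
      refine ⟨Finsupp.single e (c • w), fun e' => ?_, ?_⟩
      · rw [Finsupp.single_apply]
        split_ifs
        · exact Submodule.smul_mem _ _ (Submodule.subset_span ⟨U, hU, hk, hw⟩)
        · exact Submodule.zero_mem _
      · rw [Finsupp.sum_single_index (by simp), map_smul, mul_smul_comm, ← smul_mul_assoc,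
          smul_monomial, smul_eq_mul, mul_one]
    | add p q hp hq => rw [add_mul]; exact hadd _ _ hp hq
  | zero => exact fun r => ⟨0, fun e => Submodule.zero_mem _, by simp⟩
  | add x y _ _ hx hy => intro r; rw [mul_add]; exact hadd _ _ (hx r) (hy r)
  | smul s x _ hx => intro r; rw [smul_eq_mul, ← mul_assoc]; exact hx (r * s)

/-- If an element of the ideal of the perfect matchings of `B` lies in the ideal
`(x i | i ∈ F)` for every `F ⊆ B` containing half of the elements of `B`, then it is a combination
of products `x s * x t * f`, where `f` is the polynomial of a matching with a pair `{s, t}`. -/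
theorem mem_span_of_mem_span_X {B : Finset σ} {n : ℕ} (hB : B.card = 2 * n)
    {g : MvPolynomial σ K} (hg : g ∈ matchingIdeal K B n)
    (hX : ∀ F ⊆ B, F.card = n → g ∈ Ideal.span (X '' (F : Set σ))) :
    g ∈ Ideal.span {f : MvPolynomial σ K | ∃ U w s t, IsMatching U w ∧ s ∉ U ∧ t ∉ U ∧ s ≠ t ∧
      insert s (insert t U) ⊆ B ∧ (insert s (insert t U)).card = 2 * n ∧
      f = X s * X t * ((X s - X t) * multilinearPoly w)} := by
  obtain ⟨v, hv, rfl⟩ := exists_finsupp_of_mem_matchingIdeal hg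
  refine Submodule.sum_mem _ fun e he => ?_
  have hmono : ∀ e, ∀ U, v e U ≠ 0 → U ⊆ B ∧ U.card = n := fun e U =>
    (matchingSpan_le _ _ (hv e)).1 U
  have h0 : ∀ U, e.support ∩ B ⊆ U → v e U = 0 := by
    intro U hU
    by_contra hne
    obtain ⟨hUB, hUn⟩ := hmono e U hne
    have hcoeff : coeff (e + sqfreeExponent U)
        (v.sum fun e w => monomial e 1 * multilinearPoly w) = v e U := by
      rw [Finsupp.sum, coeff_sum, Finset.sum_eq_single e]
      · rw [coeff_monomial_mul, one_mul, coeff_multilinearPoly]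
      · intro e' _ hee'
        rw [coeff_monomial_mul']
        split_ifs with hle
        · rw [one_mul]
          by_contra hc
          obtain ⟨U', hm, hU'⟩ := exists_of_coeff_multilinearPoly_ne_zero hc
          obtain ⟨hUB', hUn'⟩ := hmono e' U' hU'
          have heq : e + sqfreeExponent U = e' + sqfreeExponent U' := by
            rw [← hm, add_tsub_cancel_of_le hle]
          have hsub : U' ⊆ U := by
            intro i hi
            by_contra hiU
            have h1 := DFunLike.congr_fun heq i
            simp only [Finsupp.add_apply, sqfreeExponent_apply, hi, hiU, if_true, if_false] at h1
            exact hiU (hU (Finset.mem_inter.2 ⟨Finsupp.mem_support_iff.2 (by omega), hUB' hi⟩))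
          rw [Finset.eq_of_subset_of_card_le hsub (by omega)] at heq
          exact hee' (add_right_cancel heq).symm
        · rfl
      · intro h
        simp [Finsupp.notMem_support_iff.1 h]
    have hm : e + sqfreeExponent U ∈
        (v.sum fun e w => monomial e 1 * multilinearPoly w).support := by
      rw [mem_support_iff, hcoeff]
      exact hne
    obtain ⟨i, hi, hie⟩ := mem_ideal_span_X_image.1 (hX (B \ U) Finset.sdiff_subset
      (by rw [Finset.card_sdiff_of_subset hUB]; omega)) _ hm
    rw [Finset.mem_coe, Finset.mem_sdiff] at hi
    simp only [Finsupp.add_apply, sqfreeExponent_apply, hi.2, if_false, add_zero] at hie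
    exact hi.2 (hU (Finset.mem_inter.2 ⟨Finsupp.mem_support_iff.2 hie, hi.1⟩))
  have hmem := mem_matchingSpanIn (e.support ∩ B) B n (v e) Finset.inter_subset_right hB.ge
    (matchingSpan_le _ _ (hv e)) h0
  beta_reduce
  generalize v e = w at hmem ⊢
  induction hmem using Submodule.span_induction with
  | mem w hw =>
    rcases hw with ⟨U, hU, hUn, -, hEU⟩ | ⟨U, u, s, t, hu, hs, ht, hst, hsE, htE, hU, hUn, rfl⟩
    · rw [Finset.eq_of_subset_of_card_le hU (by omega)] at hEU
      exact absurd Finset.inter_subset_right hEU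
    · rw [hu.multilinearPoly_insert hs ht]
      have hdvd : X s * X t ∣ (monomial e (1 : K)) := by
        have hs1 := Finsupp.mem_support_iff.1 (Finset.mem_inter.1 hsE).1
        have ht1 := Finsupp.mem_support_iff.1 (Finset.mem_inter.1 htE).1
        rw [X, X, monomial_mul, one_mul]
        refine monomial_dvd_monomial.2 ⟨Or.inr fun i => ?_, dvd_rfl⟩
        simp only [Finsupp.add_apply, Finsupp.single_apply]
        by_cases h1 : s = i <;> by_cases h2 : t = i
        · exact absurd (h1.trans h2.symm) hst
        · subst h1; simp [h2]; omega
        · subst h2; simp [h1]; omega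
        · simp [h1, h2]
      obtain ⟨q, hq⟩ := hdvd
      rw [hq, mul_comm (X s * X t) q, mul_assoc]
      exact Ideal.mul_mem_left _ _ (Ideal.subset_span
        ⟨U, u, s, t, hu, hs, ht, hst, hU, hUn, rfl⟩)
  | zero => simp
  | add x y _ _ hx hy => rw [map_add, mul_add]; exact Submodule.add_mem _ hx hy
  | smul c x _ hx =>
    rw [map_smul, mul_smul_comm, smul_eq_C_mul]
    exact Ideal.mul_mem_left _ _ hx

/-- Modulo the ideal of `(k + 1)`-matchings in `A ∪ {a}`, the variable `a` can be eliminated from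
elements of the ideal of `k`-matchings in `A`. -/
theorem exists_sub_mem_substVar_eq {A : Finset σ} {a : σ} (ha : a ∉ A) {k : ℕ}
    (hk : 2 * k < A.card) {f : MvPolynomial σ K} (hf : f ∈ matchingIdeal K A k) :
    ∃ f', f - f' ∈ matchingIdeal K (insert a A) (k + 1) ∧ ∀ t, substVar K a t f' = f' := by
  suffices H : ∀ r : MvPolynomial σ K, ∃ f', r * f - f' ∈ matchingIdeal K (insert a A) (k + 1) ∧
      ∀ t, substVar K a t f' = f' by simpa using H 1
  induction hf using Submodule.span_induction with
  | mem g hg =>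
    obtain ⟨U, hU, hUk, w, hw, rfl⟩ := hg
    obtain ⟨b, hbA, hbU⟩ := Finset.exists_mem_notMem_of_card_lt_card (hUk ▸ hk)
    have haU : a ∉ U := fun h => ha (hU h)
    have hab : a ≠ b := fun h => ha (h ▸ hbA)
    intro r
    refine ⟨substVar K a b r * multilinearPoly w, ?_, fun t => ?_⟩
    · obtain ⟨q, hq⟩ := Ideal.mem_span_singleton.1 (sub_substVar_mem a b r)
      rw [← sub_mul, hq, mul_comm (X a - X b) q, mul_assoc]
      exact Ideal.mul_mem_left _ _ (hw.sub_mul_mem_matchingIdeal haU hbU hab (by simp)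
        (by simp [hbA]) (hU.trans (Finset.subset_insert _ _)) hUk)
    · rw [map_mul, substVar_substVar hab.symm, hw.map_eq]
      intro i hi j hj
      rw [substVar_X, substVar_X, if_neg fun h => haU (by rwa [← h]),
        if_neg fun h => haU (by rwa [← h])]
  | zero => exact fun r => ⟨0, by simp⟩
  | add x y _ _ hx hy =>
    intro r
    obtain ⟨x', hx1, hx2⟩ := hx r
    obtain ⟨y', hy1, hy2⟩ := hy r
    refine ⟨x' + y', ?_, fun t => by rw [map_add, hx2, hy2]⟩
    rw [mul_add, add_sub_add_comm]
    exact Submodule.add_mem _ hx1 hy1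
  | smul s x _ hx => intro r; rw [smul_eq_mul, ← mul_assoc]; exact hx (r * s)

end Polynomials

section IntersectionOfPrimes

variable {K : Type*} [Field K] {N : ℕ}

theorem X_sub_X_mem_PFIdeal {F : Finset (Fin N)} {i j : Fin N} (hi : i ∈ F) (hj : j ∈ F) :
    (X i - X j : MvPolynomial (Fin N) K) ∈ PFIdeal K F :=
  Ideal.subset_span ⟨i, hi, j, hj, rfl⟩

theorem IsMatching.mem_PFIdeal {U F : Finset (Fin N)} {w : Finset (Fin N) → K}
    (h : IsMatching U w) (hF : U.card < 2 * (F ∩ U).card) :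
    multilinearPoly w ∈ PFIdeal K F := by
  induction h with
  | empty => simp at hF
  | @insert U w a b h ha hb hab ih =>
    rw [h.multilinearPoly_insert ha hb]
    by_cases hF' : a ∈ F ∧ b ∈ F
    · exact Ideal.mul_mem_right _ _ (X_sub_X_mem_PFIdeal hF'.1 hF'.2)
    · refine Ideal.mul_mem_left _ _ (ih ?_)
      rw [Finset.card_insert_of_notMem (by simp [ha, hab]), Finset.card_insert_of_notMem hb] at hF
      have : (F ∩ Insert.insert a (Insert.insert b U)).card ≤ (F ∩ U).card + 1 := by
        by_cases haF : a ∈ F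
        · rw [Finset.inter_insert_of_mem haF,
            Finset.inter_insert_of_notMem fun hbF => hF' ⟨haF, hbF⟩]
          exact Finset.card_insert_le _ _
        · rw [Finset.inter_insert_of_notMem haF]
          by_cases hbF : b ∈ F
          · rw [Finset.inter_insert_of_mem hbF]
            exact Finset.card_insert_le _ _
          · rw [Finset.inter_insert_of_notMem hbF]
            omega
      omega

theorem matchingIdeal_le_PFIdeal {A F : Finset (Fin N)} {m k : ℕ} (hF : F ⊆ A)
    (hFm : F.card = m + 1) (hk : A.card = m + k) : matchingIdeal K A k ≤ PFIdeal K F := by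
  refine Ideal.span_le.2 ?_
  rintro _ ⟨U, hU, hUk, w, hw, rfl⟩
  refine hw.mem_PFIdeal ?_
  have h1 := Finset.card_union_add_card_inter F U
  have h2 := Finset.card_le_card (Finset.union_subset hF hU)
  omega

theorem mem_PFIdeal_of_substVar_eq {F : Finset (Fin N)} (hF : F.Nonempty) {a : Fin N}
    {f : MvPolynomial (Fin N) K} (hf : f ∈ PFIdeal K (insert a F))
    (hs : ∀ t, substVar K a t f = f) : f ∈ PFIdeal K F := by
  obtain ⟨t, ht⟩ := hF
  have hX : ∀ i ∈ insert a F, ∃ i' ∈ F, substVar K a t (X i) = X i' := by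
    intro i hi
    rw [substVar_X]
    split_ifs with h
    · exact ⟨t, ht, rfl⟩
    · exact ⟨i, (Finset.mem_insert.1 hi).resolve_left h, rfl⟩
  have hle : PFIdeal K (insert a F) ≤ (PFIdeal K F).comap (substVar K a t) := by
    refine Ideal.span_le.2 ?_
    rintro _ ⟨i, hi, j, hj, rfl⟩
    obtain ⟨i', hi', hi⟩ := hX i hi
    obtain ⟨j', hj', hj⟩ := hX j hj
    rw [SetLike.mem_coe, Ideal.mem_comap, map_sub, hi, hj]
    exact X_sub_X_mem_PFIdeal hi' hj'
  rw [← hs t]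
  exact hle hf

theorem shiftVars_mem_span_X {F : Finset (Fin N)} {y : Fin N} {f : MvPolynomial (Fin N) K}
    (hf : f ∈ PFIdeal K (insert y F)) :
    shiftVars y 1 f ∈ Ideal.span (X '' (F : Set (Fin N))) := by
  have hX : ∀ i ∈ insert y F,
      shiftVars y (1 : K) (X i) - X y ∈ Ideal.span (X '' (F : Set (Fin N))) := by
    intro i hi
    rw [shiftVars_X]
    split_ifs with h
    · rw [h, sub_self]
      exact Submodule.zero_mem _
    · rw [map_one, one_mul, add_sub_cancel_right]
      exact Ideal.subset_span ⟨i, (Finset.mem_insert.1 hi).resolve_left h, rfl⟩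
  have hle : PFIdeal K (insert y F) ≤
      (Ideal.span (X '' (F : Set (Fin N)))).comap (shiftVars y (1 : K)) := by
    refine Ideal.span_le.2 ?_
    rintro _ ⟨i, hi, j, hj, rfl⟩
    rw [SetLike.mem_coe, Ideal.mem_comap, map_sub]
    simpa using Submodule.sub_mem _ (hX i hi) (hX j hj)
  exact hle hf

theorem shiftVars_mem_matchingIdeal {B : Finset (Fin N)} {y : Fin N} (hy : y ∉ B) (c : K) {k : ℕ}
    {f : MvPolynomial (Fin N) K} (hf : f ∈ matchingIdeal K B k) :
    shiftVars y c f ∈ matchingIdeal K B k := by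
  have hle : matchingIdeal K B k ≤ (matchingIdeal K B k).comap (shiftVars y c) := by
    refine Ideal.span_le.2 ?_
    rintro _ ⟨U, hU, hUk, w, hw, rfl⟩
    rw [SetLike.mem_coe, Ideal.mem_comap, hw.map_eq]
    · exact hw.mem_matchingIdeal hU hUk
    · intro i hi j hj
      rw [shiftVars_X, shiftVars_X, if_neg fun h => hy (hU (by rwa [← h])),
        if_neg fun h => hy (hU (by rwa [← h])), add_sub_add_right_eq_sub]
  exact hle hf

/-- The product of a Vandermonde determinant in three variables with the polynomial of a matching
is a combination of polynomials of matchings using a fourth variable. -/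
theorem vandermonde_mul_mem_matchingIdeal {U A : Finset (Fin N)} {w : Finset (Fin N) → K}
    (hw : IsMatching U w) {a y s t : Fin N} (ha : a ∉ insert y (insert s (insert t U)))
    (hy : y ∉ insert s (insert t U)) (hs : s ∉ U) (ht : t ∉ U) (hst : s ≠ t) {k : ℕ}
    (hk : U.card = 2 * k) (hA : insert a (insert y (insert s (insert t U))) ⊆ A) :
    (X s - X y) * (X t - X y) * ((X s - X t) * multilinearPoly w) ∈
      matchingIdeal K A (k + 1 + 1) := by
  simp only [Finset.mem_insert, not_or] at ha hy
  obtain ⟨hay, has, hat, haU⟩ := ha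
  obtain ⟨hys, hyt, hyU⟩ := hy
  have key : ∀ p q r : Fin N, p ∉ U → q ∉ U → r ∉ U → p ≠ q → p ≠ r → q ≠ r → a ≠ p → a ≠ q →
      a ≠ r → p ∈ A → q ∈ A → r ∈ A →
      (X p - X a) * ((X q - X r) * multilinearPoly w) ∈ matchingIdeal K A (k + 1 + 1) := by
    intro p q r hp hq hr hpq hpr hqr hap haq har hpA hqA hrA
    rw [← hw.multilinearPoly_insert hq hr]
    refine (hw.insert hq hr hqr).sub_mul_mem_matchingIdeal ?_ ?_ hap.symm hpA (hA (by simp)) ?_ ?_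
    · simp [hpq, hpr, hp]
    · simp [haq, har, haU]
    · refine Finset.insert_subset hqA (Finset.insert_subset hrA fun i hi => hA (by simp [hi]))
    · rw [Finset.card_insert_of_notMem (by simp [hq, hqr]), Finset.card_insert_of_notMem hr, hk]
      ring
  have hyA : y ∈ A := hA (by simp)
  have hsA : s ∈ A := hA (by simp)
  have htA : t ∈ A := hA (by simp)
  have h1 := key y s t hyU hs ht hys hyt hst hay has hat hyA hsA htA
  have h2 := key s y t hs hyU ht (Ne.symm hys) hst hyt has hay hat hsA hyA htA
  have h3 := key t y s ht hyU hs (Ne.symm hyt) hst.symm hys hat hay has htA hyA hsA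
  have : (X s - X y) * (X t - X y) * ((X s - X t) * multilinearPoly w) =
      X y * ((X y - X a) * ((X s - X t) * multilinearPoly w)) -
      X s * ((X s - X a) * ((X y - X t) * multilinearPoly w)) +
      X t * ((X t - X a) * ((X y - X s) * multilinearPoly w)) := by ring
  rw [this]
  exact Submodule.add_mem _ (Submodule.sub_mem _ (Ideal.mul_mem_left _ _ h1)
    (Ideal.mul_mem_left _ _ h2)) (Ideal.mul_mem_left _ _ h3)

theorem shiftVars_neg_one_mem_matchingIdeal {B : Finset (Fin N)} {a y : Fin N} {p : ℕ}
    (ha : a ∉ insert y B) (hy : y ∉ B) {g : MvPolynomial (Fin N) K}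
    (hg : g ∈ Ideal.span {f : MvPolynomial (Fin N) K | ∃ U w s t, IsMatching U w ∧ s ∉ U ∧ t ∉ U ∧
      s ≠ t ∧ insert s (insert t U) ⊆ B ∧ (insert s (insert t U)).card = 2 * p ∧
      f = X s * X t * ((X s - X t) * multilinearPoly w)}) :
    shiftVars y (-1) g ∈ matchingIdeal K (insert a (insert y B)) (p + 1) := by
  refine (Ideal.span_le (I := (matchingIdeal K (insert a (insert y B)) (p + 1)).comap
    (shiftVars y (-1)))).2 ?_ hg
  rintro _ ⟨U, w, s, t, hw, hs, ht, hst, hU, hUc, rfl⟩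
  have hys : s ≠ y := fun h => hy (hU (by simp [h]))
  have hyt : t ≠ y := fun h => hy (hU (by simp [h]))
  rw [Finset.card_insert_of_notMem (by simp [hs, hst]), Finset.card_insert_of_notMem ht] at hUc
  obtain ⟨q, rfl⟩ : ∃ q, p = q + 1 := ⟨p - 1, by omega⟩
  have hmap : shiftVars y (-1) (X s * X t * ((X s - X t) * multilinearPoly w)) =
      (X s - X y) * (X t - X y) * ((X s - X t) * multilinearPoly w) := by
    have hyU : y ∉ U := fun h => hy (hU (by simp [h]))
    rw [map_mul, map_mul, map_mul, map_sub, hw.map_eq]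
    · simp only [shiftVars_X, if_neg hys, if_neg hyt, map_neg, map_one]
      ring
    · intro i hi j hj
      rw [shiftVars_X, shiftVars_X, if_neg fun h => hyU (by rwa [← h]),
        if_neg fun h => hyU (by rwa [← h]), add_sub_add_right_eq_sub]
  rw [SetLike.mem_coe, Ideal.mem_comap, hmap]
  have hU' := Finset.insert_subset_insert y hU
  exact vandermonde_mul_mem_matchingIdeal hw (fun h => ha (hU' h)) (fun h => hy (hU h)) hs ht hst
    (by omega) (Finset.insert_subset_insert a hU')

theorem mem_matchingIdeal_insert_insert {B : Finset (Fin N)} {a y : Fin N} {p : ℕ}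
    (ha : a ∉ insert y B) (hy : y ∉ B) (hB : B.card = 2 * p) {f : MvPolynomial (Fin N) K}
    (hfB : f ∈ matchingIdeal K B p)
    (hf : ∀ F ⊆ insert y B, F.card = p + 1 → f ∈ PFIdeal K F) :
    f ∈ matchingIdeal K (insert a (insert y B)) (p + 1) := by
  have hg := mem_span_of_mem_span_X hB (shiftVars_mem_matchingIdeal hy 1 hfB)
    fun F hF hFp => shiftVars_mem_span_X (hf _ (Finset.insert_subset_insert y hF)
      (by rw [Finset.card_insert_of_notMem fun h => hy (hF h), hFp]))
  have := shiftVars_neg_one_mem_matchingIdeal ha hy hg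
  rwa [shiftVars_neg_shiftVars] at this

theorem exists_insert_eq {A : Finset (Fin N)} (hA : 0 < A.card) :
    ∃ a B, a ∉ B ∧ A = insert a B := by
  obtain ⟨a, ha⟩ := Finset.card_pos.1 hA
  exact ⟨a, A.erase a, by simp, (Finset.insert_erase ha).symm⟩

theorem mem_matchingIdeal_of_forall_mem_PFIdeal (A : Finset (Fin N)) : ∀ (m k : ℕ)
    (f : MvPolynomial (Fin N) K), A.card = m + k → k ≤ m →
      (∀ F ⊆ A, F.card = m + 1 → f ∈ PFIdeal K F) → f ∈ matchingIdeal K A k := by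
  induction A using Finset.strongInduction with
  | _ A ih =>
  intro m k f hAc hkm hf
  rcases k with _ | k
  · rw [matchingIdeal_zero]
    exact Submodule.mem_top
  obtain ⟨a, A, ha, rfl⟩ := exists_insert_eq (A := A) (by omega)
  rw [Finset.card_insert_of_notMem ha] at hAc
  obtain ⟨p, rfl⟩ : ∃ p, m = p + 1 := ⟨m - 1, by omega⟩
  obtain ⟨f', hff', hsub⟩ := exists_sub_mem_substVar_eq ha (k := k) (by omega)
    (ih A (Finset.ssubset_insert ha) (p + 1) k f (by omega) (by omega)
      fun F hF => hf F (hF.trans (Finset.subset_insert _ _)))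
  have hf' : ∀ F ⊆ A, F.card = p + 1 → f' ∈ PFIdeal K F := by
    intro F hF hFp
    refine mem_PFIdeal_of_substVar_eq (Finset.card_pos.1 (by omega)) (a := a) ?_ hsub
    have hF' := Finset.insert_subset_insert a hF
    have hFc : (insert a F).card = p + 1 + 1 := by
      rw [Finset.card_insert_of_notMem fun h => ha (hF h), hFp]
    have := matchingIdeal_le_PFIdeal hF' hFc
      (by rw [Finset.card_insert_of_notMem ha]; omega) hff'
    exact (Submodule.sub_mem_iff_right _ (hf _ hF' hFc)).1 this
  refine (Submodule.sub_mem_iff_left _ ?_).1 hff'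
  rcases Nat.lt_or_ge p (k + 1) with hpk | hpk
  · obtain rfl : p = k := by omega
    obtain ⟨y, B, hy, rfl⟩ := exists_insert_eq (A := A) (by omega)
    rw [Finset.card_insert_of_notMem hy] at hAc
    refine mem_matchingIdeal_insert_insert ha hy (by omega) ?_ hf'
    exact ih B ((Finset.ssubset_insert hy).trans (Finset.ssubset_insert ha)) p p f' (by omega)
      le_rfl fun F hF => hf' F (hF.trans (Finset.subset_insert _ _))
  · exact matchingIdeal_mono (Finset.subset_insert _ _) _
      (ih A (Finset.ssubset_insert ha) p (k + 1) f' (by omega) hpk hf')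

theorem InkIdeal_eq_matchingIdeal {m k : ℕ} (hN : N = m + k) (hk : k ≤ m) :
    InkIdeal K N (m + 1) = matchingIdeal K (Finset.univ : Finset (Fin N)) k := by
  have hc : (Finset.univ : Finset (Fin N)).card = m + k := by simp [hN]
  refine le_antisymm (fun f hf => ?_) ?_
  · simp only [InkIdeal, Ideal.mem_iInf] at hf
    exact mem_matchingIdeal_of_forall_mem_PFIdeal _ m k f hc hk fun F _ hF => hf F hF
  · exact le_iInf₂ fun F hF => matchingIdeal_le_PFIdeal (Finset.subset_univ F) hF hc

end IntersectionOfPrimes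

section MinimalNumberOfGenerators

variable {σ K : Type*} [Fintype σ] [DecidableEq σ] [Field K]

/-- The coefficients of the squarefree monomials of degree `k`. -/
noncomputable def sqfreeCoeff (k : ℕ) : MvPolynomial σ K →ₗ[K] (Finset σ → K) where
  toFun f U := if U.card = k then coeff (sqfreeExponent U) f else 0
  map_add' f g := by ext U; by_cases h : U.card = k <;> simp [h]
  map_smul' c f := by ext U; by_cases h : U.card = k <;> simp [h]

theorem sqfreeCoeff_multilinearPoly {A : Finset σ} {k : ℕ} {w : Finset σ → K}
    (hw : w ∈ translationInvariant K A k) : sqfreeCoeff k (multilinearPoly w) = w := by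
  ext U
  by_cases h : U.card = k
  · simp [sqfreeCoeff, h, coeff_multilinearPoly]
  · by_cases h0 : w U = 0
    · simp [sqfreeCoeff, h, h0]
    · exact absurd (hw.1 U h0).2 h

omit [Fintype σ] in
theorem sqfreeCoeff_mul {k : ℕ} {f : MvPolynomial σ K} (hf : f ∈ idealOfVars σ K ^ k)
    (r : MvPolynomial σ K) : sqfreeCoeff k (r * f) = coeff 0 r • sqfreeCoeff k f := by
  rw [mem_pow_idealOfVars_iff'] at hf
  ext U
  by_cases h : U.card = k
  · simp only [sqfreeCoeff, LinearMap.coe_mk, AddHom.coe_mk, if_pos h, Pi.smul_apply, smul_eq_mul]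
    rw [coeff_mul, Finset.sum_eq_single (0, sqfreeExponent U)]
    · rintro ⟨e, d⟩ hed hne
      rw [Finset.HasAntidiagonal.mem_antidiagonal] at hed
      rw [hf d, mul_zero]
      have h1 := congrArg Finsupp.degree hed
      simp only [map_add, degree_sqfreeExponent, h] at h1
      have h2 : e.degree ≠ 0 := by
        rw [ne_eq, Finsupp.degree_eq_zero_iff]
        rintro rfl
        exact hne (by simpa using hed)
      omega
    · simp
  · simp [sqfreeCoeff, h]

theorem matchingIdeal_le_pow (A : Finset σ) (k : ℕ) :
    matchingIdeal K A k ≤ idealOfVars σ K ^ k := by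
  refine Ideal.span_le.2 ?_
  rintro _ ⟨U, hU, hk, w, hw, rfl⟩
  refine (mem_pow_idealOfVars_iff _ _).2 fun m hm => ?_
  obtain ⟨S, rfl, hS⟩ := exists_of_coeff_multilinearPoly_ne_zero (mem_support_iff.1 hm)
  rw [degree_sqfreeExponent, ((hw.mem k hk).1 S hS).2]

theorem finrank_le_card_of_span_eq {A : Finset σ} {k : ℕ} {s : Finset (MvPolynomial σ K)}
    (hs : Ideal.span (s : Set (MvPolynomial σ K)) = matchingIdeal K A k) :
    Module.finrank K (matchingSpan K A k) ≤ s.card := by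
  classical
  have hmem : ∀ f ∈ Ideal.span (s : Set (MvPolynomial σ K)),
      sqfreeCoeff k f ∈ Submodule.span K (s.image (sqfreeCoeff k) : Set (Finset σ → K)) := by
    intro f hf
    induction hf using Submodule.span_induction with
    | mem f hf => exact Submodule.subset_span (by simpa using ⟨f, hf, rfl⟩)
    | zero => rw [map_zero]; exact Submodule.zero_mem _
    | add f g _ _ hf hg => rw [map_add]; exact Submodule.add_mem _ hf hg
    | smul r f hf' hf =>
      have hf' : f ∈ Ideal.span (s : Set (MvPolynomial σ K)) := hf'
      rw [smul_eq_mul, sqfreeCoeff_mul (matchingIdeal_le_pow A k (hs ▸ hf'))]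
      exact Submodule.smul_mem _ _ hf
  have hle : matchingSpan K A k ≤
      Submodule.span K (s.image (sqfreeCoeff k) : Set (Finset σ → K)) := by
    intro w hw
    rw [← sqfreeCoeff_multilinearPoly (matchingSpan_le A k hw)]
    refine hmem _ ?_
    rw [hs, matchingIdeal_eq_span_image]
    exact Ideal.subset_span ⟨w, hw, rfl⟩
  exact (Submodule.finrank_mono hle).trans
    ((finrank_span_finset_le_card _).trans Finset.card_image_le)

theorem multilinearPoly_injective :
    Function.Injective (multilinearPoly : (Finset σ → K) →ₗ[K] MvPolynomial σ K) := by
  intro v w h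
  ext U
  rw [← coeff_multilinearPoly v, h, coeff_multilinearPoly]

theorem exists_finset_card_eq_finrank (A : Finset σ) (k : ℕ) :
    ∃ s : Finset (MvPolynomial σ K), s.card = Module.finrank K (matchingSpan K A k) ∧
      Ideal.span (s : Set (MvPolynomial σ K)) = matchingIdeal K A k := by
  classical
  let b := Module.finBasis K (matchingSpan K A k)
  refine ⟨Finset.univ.image fun i => multilinearPoly (b i : Finset σ → K), ?_, ?_⟩
  · rw [Finset.card_image_of_injective _ fun i j h =>
      b.injective (Subtype.ext (multilinearPoly_injective h))]
    simp
  · rw [matchingIdeal_eq_span_image]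
    refine le_antisymm (Ideal.span_mono ?_) (Ideal.span_le.2 ?_)
    · intro f hf
      obtain ⟨i, -, rfl⟩ := Finset.mem_image.1 (Finset.mem_coe.1 hf)
      exact ⟨b i, (b i).2, rfl⟩
    · rintro _ ⟨w, hw, rfl⟩
      have hsum := congrArg (multilinearPoly ∘ₗ (matchingSpan K A k).subtype)
        (b.sum_repr ⟨w, hw⟩)
      rw [map_sum] at hsum
      change _ = multilinearPoly w at hsum
      rw [SetLike.mem_coe, ← hsum]
      refine Submodule.sum_mem _ fun i _ => ?_
      rw [map_smul, smul_eq_C_mul]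
      exact Ideal.mul_mem_left _ _ (Ideal.subset_span (by simp))

theorem minNumGens_matchingIdeal {A : Finset σ} {k : ℕ} (hk : 2 * k ≤ A.card) :
    minNumGens (matchingIdeal K A k) = Module.finrank K (translationInvariant K A k) := by
  rw [translationInvariant_eq_matchingSpan hk]
  refine le_antisymm (Nat.sInf_le (exists_finset_card_eq_finrank A k)) ?_
  refine le_csInf ⟨_, exists_finset_card_eq_finrank A k⟩ ?_
  rintro _ ⟨s, rfl, hs⟩
  exact finrank_le_card_of_span_eq hs

end MinimalNumberOfGenerators

theorem catalan_succ_add_choose (k : ℕ) :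
    catalan (k + 1) + (2 * k + 2).choose k = (2 * k + 2).choose (k + 1) := by
  have h1 := succ_mul_catalan_eq_centralBinom (k + 1)
  rw [Nat.centralBinom_eq_two_mul_choose, show 2 * (k + 1) = 2 * k + 2 by ring] at h1
  have h2 := Nat.choose_succ_right_eq (2 * k + 2) k
  rw [show 2 * k + 2 - k = k + 2 by omega] at h2
  have : 0 < k + 2 := by omega
  refine Nat.eq_of_mul_eq_mul_left this ?_
  rw [mul_add, h1]
  linarith

theorem catalan_eq_choose_div (n : ℕ) :
    catalan n = (2 * n + 1).choose n / (2 * n + 1) := by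
  have h1 := succ_mul_catalan_eq_centralBinom n
  rw [Nat.centralBinom_eq_two_mul_choose] at h1
  have h2 := Nat.add_one_mul_choose_eq (2 * n) n
  have h3 : (2 * n + 1).choose (n + 1) = (2 * n + 1).choose n :=
    Nat.choose_symm_of_eq_add (by omega)
  rw [h3, ← h1] at h2
  symm
  refine Nat.div_eq_of_eq_mul_right (by omega) ?_
  refine Nat.eq_of_mul_eq_mul_right (show 0 < n + 1 by omega) ?_
  rw [← h2]
  ring

theorem catalan_eq_finrank_of_card_even {σ K : Type*} [Fintype σ] [DecidableEq σ] [Field K]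
    {A : Finset σ} {k : ℕ} (hA : A.card = 2 * k + 2) :
    Module.finrank K (translationInvariant K A (k + 1)) = catalan (k + 1) := by
  have h1 := finrank_translationInvariant_succ (K := K) A k (by omega)
  have h2 := catalan_succ_add_choose k
  rw [hA] at h1
  omega

theorem catalan_eq_finrank_of_card_odd {σ K : Type*} [Fintype σ] [DecidableEq σ] [Field K]
    {A : Finset σ} {k : ℕ} (hA : A.card = 2 * k + 1) :
    Module.finrank K (translationInvariant K A k) = catalan (k + 1) := by
  cases k with
  | zero => rw [finrank_translationInvariant_zero, zero_add, catalan_one]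
  | succ l =>
    have h1 := finrank_translationInvariant_succ (K := K) A l (by omega)
    have h2 := catalan_succ_add_choose (l + 1)
    have h3 : (2 * l + 3).choose (l + 1 + 1) = (2 * l + 3).choose (l + 1) :=
      Nat.choose_symm_of_eq_add (by omega)
    rw [hA, show 2 * (l + 1) + 1 = 2 * l + 3 by ring] at h1
    rw [show 2 * (l + 1) + 2 = 2 * l + 3 + 1 by ring, Nat.choose_succ_succ' _ l,
      Nat.choose_succ_succ' _ (l + 1)] at h2
    omega


/-- Corollary 4.2: in `K[x_1, …, x_{2n}]` the ideal
`I_{2n, n+1} = ⋂_{#F = n+1} (x_i - x_j ∣ i, j ∈ F)` is minimally generated by the `n`-th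
Catalan number `C_n = (1/(2n+1))·binom(2n+1, n)` of elements, and similarly for the
ideal `I_{2n-1, n+1} ⊆ K[x_1, …, x_{2n-1}]`. -/
theorem minNumGens_Ink_eq_catalan {K : Type*} [Field K] (n : ℕ) (hn : 1 ≤ n) :
    catalan n = (2 * n + 1).choose n / (2 * n + 1) ∧
      minNumGens (InkIdeal K (2 * n) (n + 1)) = catalan n ∧
      minNumGens (InkIdeal K (2 * n - 1) (n + 1)) = catalan n := by
  obtain ⟨k, rfl⟩ : ∃ k, n = k + 1 := ⟨n - 1, by omega⟩
  refine ⟨catalan_eq_choose_div _, ?_, ?_⟩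
  · rw [InkIdeal_eq_matchingIdeal (k := k + 1) (by ring) le_rfl,
      minNumGens_matchingIdeal (by simp), catalan_eq_finrank_of_card_even]
    simp
    ring
  · rw [InkIdeal_eq_matchingIdeal (k := k) (by omega) (by omega),
      minNumGens_matchingIdeal (by rw [Finset.card_fin]; omega), catalan_eq_finrank_of_card_odd]
    rw [Finset.card_fin]
    omega
end

section
/- Let n = 2a + 1, λ = (a, a, 1) and μ = (a, a), and let φ: R → S = K[x₁,…,x_{n−1}] be the K-algebra surjection sending xₙ to 0 and xᵢ to xᵢ for i < n. Then φ(I^Sp_λ) equals the ideal of S generated by all products xᵢ·xⱼ·f_T where T ranges over Young tableaux of shape μ (with entries in {1,…,n−1}) and (i, j) runs over the pairs of entries forming a column of T (i on top of j). -/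
open MvPolynomial

/-- The natural surjection `K[x_1, …, x_n] → K[x_1, …, x_{n-1}]` sending `x_n` to `0`
and `x_i` to `x_i` for `i < n`. -/
noncomputable def lowerMap (K : Type*) [CommRing K] (n : ℕ) :
    MvPolynomial (Fin n) K →ₐ[K] MvPolynomial (Fin (n - 1)) K :=
  MvPolynomial.aeval fun i : Fin n =>
    if h : (i : ℕ) < n - 1 then MvPolynomial.X ⟨(i : ℕ), h⟩ else 0

section Boxes

variable {ι : Type*}

theorem isTableau_iff_exists_equiv {parts : List ℕ} {n : ℕ} {box : ι → ℕ × ℕ}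
    (hinj : Function.Injective box)
    (hbox : ∀ r c : ℕ, (∃ x, box x = (r, c)) ↔ r < parts.length ∧ c < parts.getD r 0)
    (T : Fin n → ℕ × ℕ) :
    IsTableau parts T ↔ ∃ e : ι ≃ Fin n, T = box ∘ e.symm := by
  constructor
  · rintro ⟨hT, hmem, hsurj⟩
    have h : ∀ x, ∃ i, T i = box x := fun x =>
      hsurj _ _ ((hbox (box x).1 (box x).2).1 ⟨x, rfl⟩).1
        ((hbox (box x).1 (box x).2).1 ⟨x, rfl⟩).2
    choose g hg using h
    have hg_bij : Function.Bijective g := by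
      refine ⟨fun x y hxy => hinj ?_, fun i => ?_⟩
      · rw [← hg, ← hg, hxy]
      · obtain ⟨x, hx⟩ := (hbox (T i).1 (T i).2).2 (hmem i)
        exact ⟨x, hT ((hg x).trans hx)⟩
    refine ⟨Equiv.ofBijective g hg_bij, funext fun i => ?_⟩
    obtain ⟨x, rfl⟩ := hg_bij.2 i
    have : (Equiv.ofBijective g hg_bij).symm (g x) = x :=
      (Equiv.ofBijective g hg_bij).symm_apply_apply x
    simp [this, hg]
  · rintro ⟨e, rfl⟩
    refine ⟨hinj.comp e.symm.injective, fun i => (hbox _ _).1 ⟨e.symm i, rfl⟩,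
      fun r c hr hc => ?_⟩
    obtain ⟨x, hx⟩ := (hbox r c).2 ⟨hr, hc⟩
    exact ⟨e x, by simpa using hx⟩

theorem spechtPoly_comp_symm [Fintype ι] (K : Type*) [CommRing K] {n : ℕ} (box : ι → ℕ × ℕ)
    (e : ι ≃ Fin n) :
    spechtPoly K (box ∘ e.symm) = ∏ x, ∏ y,
      if (box x).2 = (box y).2 ∧ (box x).1 < (box y).1 then
        (X (e x) - X (e y) : MvPolynomial (Fin n) K) else 1 := by
  rw [spechtPoly, Finset.prod_filter, Fintype.prod_prod_type, ← e.prod_comp]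
  refine Finset.prod_congr rfl fun x _ => ?_
  rw [← e.prod_comp]
  simp

end Boxes

/-- The boxes of the Young diagram of `(a, a)`: `inl c` and `inr c` are the top and the bottom
box of column `c`. -/
def twoRowBox (a : ℕ) : Fin a ⊕ Fin a → ℕ × ℕ :=
  Sum.elim (fun c => (0, (c : ℕ))) (fun c => (1, (c : ℕ)))

/-- The boxes of the Young diagram of `(a, a, 1)`: those of `(a, a)`, and `none` for the only box
of the third row. -/
def threeRowBox (a : ℕ) (x : Option (Fin a ⊕ Fin a)) : ℕ × ℕ :=
  x.elim (2, 0) (twoRowBox a)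

theorem twoRowBox_injective (a : ℕ) : Function.Injective (twoRowBox a) := by
  rintro (c | c) (d | d) h <;> simp_all [twoRowBox, Fin.ext_iff]

theorem threeRowBox_injective (a : ℕ) : Function.Injective (threeRowBox a) := by
  rintro (_ | c | c) (_ | d | d) h <;> simp_all [threeRowBox, twoRowBox, Fin.ext_iff]

theorem exists_twoRowBox_eq_iff (a r c : ℕ) :
    (∃ x, twoRowBox a x = (r, c)) ↔ r < [a, a].length ∧ c < [a, a].getD r 0 := by
  rcases r with _ | _ | r <;> simp [twoRowBox, Fin.exists_iff]

theorem exists_threeRowBox_eq_iff {a : ℕ} (r c : ℕ) :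
    (∃ x, threeRowBox a x = (r, c)) ↔ r < [a, a, 1].length ∧ c < [a, a, 1].getD r 0 := by
  rcases r with _ | _ | _ | r <;>
    simp [threeRowBox, twoRowBox, Fin.exists_iff, Option.exists, eq_comm]

theorem isTableau_twoRow_iff {a n : ℕ} (T : Fin n → ℕ × ℕ) :
    IsTableau [a, a] T ↔ ∃ e : Fin a ⊕ Fin a ≃ Fin n, T = twoRowBox a ∘ e.symm :=
  isTableau_iff_exists_equiv (twoRowBox_injective a) (exists_twoRowBox_eq_iff a) T

theorem isTableau_threeRow_iff {a n : ℕ} (T : Fin n → ℕ × ℕ) :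
    IsTableau [a, a, 1] T ↔
      ∃ e : Option (Fin a ⊕ Fin a) ≃ Fin n, T = threeRowBox a ∘ e.symm :=
  isTableau_iff_exists_equiv (threeRowBox_injective a) exists_threeRowBox_eq_iff T

theorem spechtPoly_twoRow (K : Type*) [CommRing K] {a n : ℕ} (e : Fin a ⊕ Fin a ≃ Fin n) :
    spechtPoly K (twoRowBox a ∘ e.symm) = ∏ c, (X (e (.inl c)) - X (e (.inr c))) := by
  simp [spechtPoly_comp_symm, twoRowBox, ← Fin.ext_iff]

section ThreeRow

variable {A : Type*} [CommRing A] {b : ℕ}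

/-- The value at `y` of the Specht polynomial of shape `(b + 1, b + 1, 1)`. -/
def threeRowSpecht (y : Option (Fin (b + 1) ⊕ Fin (b + 1)) → A) : A :=
  (∏ c, (y (some (.inl c)) - y (some (.inr c)))) *
    ((y (some (.inl 0)) - y none) * (y (some (.inr 0)) - y none))

theorem spechtPoly_threeRow (K : Type*) [CommRing K] {n : ℕ}
    (e : Option (Fin (b + 1) ⊕ Fin (b + 1)) ≃ Fin n) :
    spechtPoly K (threeRowBox (b + 1) ∘ e.symm) = threeRowSpecht fun x => X (e x) := by
  simp [spechtPoly_comp_symm, threeRowBox, twoRowBox, threeRowSpecht, ← Fin.ext_iff,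
    Fintype.prod_option, Finset.prod_mul_distrib, -ite_mul, -mul_ite]
  ring

theorem map_threeRowSpecht {B F : Type*} [CommRing B] [FunLike F A B] [RingHomClass F A B]
    (f : F) (y : Option (Fin (b + 1) ⊕ Fin (b + 1)) → A) :
    f (threeRowSpecht y) = threeRowSpecht (f ∘ y) := by
  simp [threeRowSpecht]

theorem threeRowSpecht_eq (y : Option (Fin (b + 1) ⊕ Fin (b + 1)) → A) :
    threeRowSpecht y =
      (∏ c ∈ Finset.univ.erase 0, (y (some (.inl c)) - y (some (.inr c)))) *
        ((y (some (.inl 0)) - y (some (.inr 0))) *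
          ((y (some (.inl 0)) - y none) * (y (some (.inr 0)) - y none))) := by
  rw [threeRowSpecht, ← Finset.mul_prod_erase _ _ (Finset.mem_univ 0)]
  ring

theorem threeRowSpecht_eq_of_ne (y : Option (Fin (b + 1) ⊕ Fin (b + 1)) → A)
    {d : Fin (b + 1)} (hd : d ≠ 0) :
    threeRowSpecht y =
      (∏ c ∈ (Finset.univ.erase 0).erase d, (y (some (.inl c)) - y (some (.inr c)))) *
        ((y (some (.inl d)) - y (some (.inr d))) *
          ((y (some (.inl 0)) - y (some (.inr 0))) *
            ((y (some (.inl 0)) - y none) * (y (some (.inr 0)) - y none)))) := by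
  rw [threeRowSpecht_eq, ← Finset.mul_prod_erase _ _
    (Finset.mem_erase.2 ⟨hd, Finset.mem_univ d⟩)]
  ring

/-- Exchanging two entries of the first column changes the sign. -/
theorem threeRowSpecht_swap_none (y : Option (Fin (b + 1) ⊕ Fin (b + 1)) → A)
    {x : Fin (b + 1) ⊕ Fin (b + 1)} (hx : x = .inl 0 ∨ x = .inr 0) :
    threeRowSpecht (y ∘ Equiv.swap none (some x)) = - threeRowSpecht y := by
  have hrest : (∏ c ∈ Finset.univ.erase 0, ((y ∘ Equiv.swap none (some x)) (some (.inl c)) -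
      (y ∘ Equiv.swap none (some x)) (some (.inr c)))) =
      ∏ c ∈ Finset.univ.erase 0, (y (some (.inl c)) - y (some (.inr c))) := by
    refine Finset.prod_congr rfl fun c hc => ?_
    have hc := Finset.ne_of_mem_erase hc
    rcases hx with rfl | rfl <;> simp [Equiv.swap_apply_def, hc]
  rw [threeRowSpecht_eq, threeRowSpecht_eq, hrest]
  rcases hx with rfl | rfl <;> simp [Equiv.swap_apply_def] <;> ring

/-- The Garnir relation between the first column and an entry of another column. -/
theorem threeRowSpecht_eq_sum_swap (y : Option (Fin (b + 1) ⊕ Fin (b + 1)) → A)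
    {d : Fin (b + 1)} (hd : d ≠ 0) {x : Fin (b + 1) ⊕ Fin (b + 1)}
    (hx : x = .inl d ∨ x = .inr d) :
    threeRowSpecht y = threeRowSpecht (y ∘ Equiv.swap none (some x)) +
      threeRowSpecht (y ∘ Equiv.swap (some (.inl 0)) (some x)) +
      threeRowSpecht (y ∘ Equiv.swap (some (.inr 0)) (some x)) := by
  have hrest : ∀ t : Option (Fin (b + 1) ⊕ Fin (b + 1)),
      t = none ∨ t = some (.inl 0) ∨ t = some (.inr 0) →
      (∏ c ∈ (Finset.univ.erase 0).erase d, ((y ∘ Equiv.swap t (some x)) (some (.inl c)) -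
        (y ∘ Equiv.swap t (some x)) (some (.inr c)))) =
      ∏ c ∈ (Finset.univ.erase 0).erase d, (y (some (.inl c)) - y (some (.inr c))) := by
    refine fun t ht => Finset.prod_congr rfl fun c hc => ?_
    have hcd := Finset.ne_of_mem_erase hc
    have hc := Finset.ne_of_mem_erase (Finset.mem_of_mem_erase hc)
    rcases hx with rfl | rfl <;> rcases ht with rfl | rfl | rfl <;>
      simp [Equiv.swap_apply_def, hc, hcd]
  simp only [threeRowSpecht_eq_of_ne _ hd]
  rw [hrest _ (.inl rfl), hrest _ (.inr (.inl rfl)), hrest _ (.inr (.inr rfl))]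
  rcases hx with rfl | rfl <;> simp [Equiv.swap_apply_def, hd, hd.symm] <;> ring

end ThreeRow

section Image

variable (K : Type*) [CommRing K] (m : ℕ)

/-- The image of the variables under `lowerMap`, the last variable being indexed by `none`. -/
noncomputable def lowerVar (o : Option (Fin m)) : MvPolynomial (Fin m) K :=
  o.elim 0 X

theorem lowerMap_X (i : Fin (m + 1)) :
    lowerMap K (m + 1) (X i) = lowerVar K m (finSuccEquivLast i) := by
  refine Fin.lastCases ?_ (fun j => ?_) i
  · simp [lowerMap, lowerVar]
  · simp [lowerMap, lowerVar]

theorem map_spechtIdeal_threeRow (b : ℕ) :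
    Ideal.map (lowerMap K (m + 1)) (spechtIdeal K (m + 1) [b + 1, b + 1, 1]) =
      Ideal.span {f | ∃ σ : Option (Fin (b + 1) ⊕ Fin (b + 1)) ≃ Option (Fin m),
        f = threeRowSpecht (lowerVar K m ∘ σ)} := by
  rw [spechtIdeal, Ideal.map_span]
  congr 1
  ext f
  simp only [isTableau_threeRow_iff, Set.mem_image, Set.mem_ofPred_eq]
  constructor
  · rintro ⟨_, ⟨_, ⟨e, rfl⟩, rfl⟩, rfl⟩
    refine ⟨e.trans finSuccEquivLast, ?_⟩
    rw [spechtPoly_threeRow, map_threeRowSpecht]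
    congr 1
    ext1 x
    exact lowerMap_X K m _
  · rintro ⟨σ, rfl⟩
    refine ⟨_, ⟨_, ⟨σ.trans finSuccEquivLast.symm, rfl⟩, rfl⟩, ?_⟩
    rw [spechtPoly_threeRow, map_threeRowSpecht]
    congr 1
    ext1 x
    exact (lowerMap_X K m _).trans (by simp)

/-- The ideal generated by the products `X i * X j * f_T`, for `T` a tableau with two rows of
length `a` and `(i, j)` a column of `T`. -/
noncomputable def columnIdeal (a : ℕ) : Ideal (MvPolynomial (Fin m) K) :=
  Ideal.span {f | ∃ T : Fin m → ℕ × ℕ, IsTableau [a, a] T ∧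
    ∃ i j : Fin m, (T i).1 = 0 ∧ (T j).1 = 1 ∧ (T i).2 = (T j).2 ∧
      f = X i * X j * spechtPoly K T}

theorem columnIdeal_eq (a : ℕ) :
    columnIdeal K m a = Ideal.span {f | ∃ (τ : Fin a ⊕ Fin a ≃ Fin m) (d : Fin a),
      f = X (τ (.inl d)) * X (τ (.inr d)) * ∏ c, (X (τ (.inl c)) - X (τ (.inr c)))} := by
  rw [columnIdeal]
  congr 1
  ext f
  simp only [isTableau_twoRow_iff, Set.mem_ofPred_eq]
  constructor
  · rintro ⟨_, ⟨τ, rfl⟩, i, j, hi, hj, hij, rfl⟩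
    obtain ⟨x, rfl⟩ := τ.surjective i
    obtain ⟨y, rfl⟩ := τ.surjective j
    rcases x with d | d <;> rcases y with d' | d' <;> simp [twoRowBox] at hi hj hij
    obtain rfl : d = d' := Fin.ext hij
    exact ⟨τ, d, by rw [spechtPoly_twoRow]⟩
  · rintro ⟨τ, d, rfl⟩
    exact ⟨_, ⟨τ, rfl⟩, τ (.inl d), τ (.inr d), by simp [twoRowBox], by simp [twoRowBox],
      by simp [twoRowBox], by rw [spechtPoly_twoRow]⟩

variable {K m} {b : ℕ}

theorem threeRowSpecht_mem_of_none (σ : Option (Fin (b + 1) ⊕ Fin (b + 1)) ≃ Option (Fin m))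
    (hσ : σ none = none) :
    threeRowSpecht (lowerVar K m ∘ σ) ∈ columnIdeal K m (b + 1) := by
  have h : ∀ x, σ (some x) = some (Equiv.removeNone σ x) := fun x =>
    (Equiv.removeNone_some σ (by
      obtain ⟨y, hy⟩ := Option.ne_none_iff_exists'.1
        (fun hx => Option.some_ne_none x (σ.injective (hx.trans hσ.symm)))
      exact ⟨y, hy⟩)).symm
  rw [columnIdeal_eq]
  refine Ideal.subset_span ⟨Equiv.removeNone σ, 0, ?_⟩
  simp only [threeRowSpecht, Function.comp_apply, h, hσ, lowerVar, Option.elim_some,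
    Option.elim_none]
  ring

theorem threeRowSpecht_mem_of_first_column
    (σ : Option (Fin (b + 1) ⊕ Fin (b + 1)) ≃ Option (Fin m))
    (hσ : σ none = none ∨ σ (some (.inl 0)) = none ∨ σ (some (.inr 0)) = none) :
    threeRowSpecht (lowerVar K m ∘ σ) ∈ columnIdeal K m (b + 1) := by
  have key : ∀ x : Fin (b + 1) ⊕ Fin (b + 1), x = .inl 0 ∨ x = .inr 0 → σ (some x) = none →
      threeRowSpecht (lowerVar K m ∘ σ) ∈ columnIdeal K m (b + 1) := fun x hx h => by
    rw [← neg_mem_iff, ← threeRowSpecht_swap_none _ hx, Function.comp_assoc,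
      ← Equiv.coe_trans]
    exact threeRowSpecht_mem_of_none ((Equiv.swap none (some x)).trans σ) (by simp [h])
  rcases hσ with h | h | h
  · exact threeRowSpecht_mem_of_none σ h
  · exact key _ (.inl rfl) h
  · exact key _ (.inr rfl) h

theorem threeRowSpecht_swap_mem
    (σ : Option (Fin (b + 1) ⊕ Fin (b + 1)) ≃ Option (Fin m))
    {t s : Option (Fin (b + 1) ⊕ Fin (b + 1))}
    (ht : t = none ∨ t = some (.inl 0) ∨ t = some (.inr 0)) (hs : σ s = none) :
    threeRowSpecht ((lowerVar K m ∘ σ) ∘ Equiv.swap t s) ∈ columnIdeal K m (b + 1) := by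
  have h : ((Equiv.swap t s).trans σ) t = none := by simp [hs]
  rw [Function.comp_assoc, ← Equiv.coe_trans]
  refine threeRowSpecht_mem_of_first_column _ ?_
  rcases ht with ht | ht | ht
  · exact .inl (ht ▸ h)
  · exact .inr (.inl (ht ▸ h))
  · exact .inr (.inr (ht ▸ h))

theorem threeRowSpecht_mem (σ : Option (Fin (b + 1) ⊕ Fin (b + 1)) ≃ Option (Fin m)) :
    threeRowSpecht (lowerVar K m ∘ σ) ∈ columnIdeal K m (b + 1) := by
  have key : ∀ (d : Fin (b + 1)) (x : Fin (b + 1) ⊕ Fin (b + 1)), x = .inl d ∨ x = .inr d →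
      σ (some x) = none → threeRowSpecht (lowerVar K m ∘ σ) ∈ columnIdeal K m (b + 1) := by
    intro d x hx h
    by_cases hd : d = 0
    · subst hd
      refine threeRowSpecht_mem_of_first_column σ ?_
      rcases hx with rfl | rfl
      · exact .inr (.inl h)
      · exact .inr (.inr h)
    · rw [threeRowSpecht_eq_sum_swap _ hd hx]
      exact add_mem (add_mem (threeRowSpecht_swap_mem σ (.inl rfl) h)
        (threeRowSpecht_swap_mem σ (.inr (.inl rfl)) h))
        (threeRowSpecht_swap_mem σ (.inr (.inr rfl)) h)
  obtain ⟨x, hx⟩ := σ.surjective none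
  rcases x with _ | d | d
  · exact threeRowSpecht_mem_of_none σ hx
  · exact key d _ (.inl rfl) hx
  · exact key d _ (.inr rfl) hx

theorem threeRowSpecht_optionCongr (τ : Fin (b + 1) ⊕ Fin (b + 1) ≃ Fin m) (d : Fin (b + 1)) :
    threeRowSpecht (lowerVar K m ∘ Equiv.optionCongr
      ((Equiv.sumCongr (Equiv.swap 0 d) (Equiv.swap 0 d)).trans τ)) =
      X (τ (.inl d)) * X (τ (.inr d)) * ∏ c, (X (τ (.inl c)) - X (τ (.inr c))) := by
  rw [← Equiv.prod_comp (Equiv.swap 0 d) fun c =>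
    (X (τ (.inl c)) - X (τ (.inr c)) : MvPolynomial (Fin m) K)]
  simp [threeRowSpecht, lowerVar]
  ring

variable (K m b) in
theorem map_spechtIdeal_eq_columnIdeal :
    Ideal.map (lowerMap K (m + 1)) (spechtIdeal K (m + 1) [b + 1, b + 1, 1]) =
      columnIdeal K m (b + 1) := by
  rw [map_spechtIdeal_threeRow]
  apply le_antisymm
  · rw [Ideal.span_le]
    rintro _ ⟨σ, rfl⟩
    exact threeRowSpecht_mem σ
  · rw [columnIdeal_eq, Ideal.span_le]
    rintro _ ⟨τ, d, rfl⟩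
    exact Ideal.subset_span ⟨_, (threeRowSpecht_optionCongr τ d).symm⟩

end Image

/-- Lemma 4.4: for `n = 2a + 1`, `λ = (a, a, 1)` and `μ = (a, a)`, the image of
`I^Sp_λ` under the natural surjection `φ : K[x_1, …, x_n] → K[x_1, …, x_{n-1}]`
(sending `x_n` to `0`) is the ideal generated by the products `x_i · x_j · f_T`, where
`T` runs over the Young tableaux of shape `μ` with entries in `{1, …, n-1}` and
`(i, j)` runs over the columns of `T` (`i` on top of `j`). -/
theorem image_specht_aa1 {K : Type*} [Field K] (n a : ℕ)
    (ha : 1 ≤ a) (hn : n = 2 * a + 1) :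
    Ideal.map (lowerMap K n) (spechtIdeal K n [a, a, 1]) =
      Ideal.span {f | ∃ T : Fin (n - 1) → ℕ × ℕ, IsTableau [a, a] T ∧
        ∃ i j : Fin (n - 1), (T i).1 = 0 ∧ (T j).1 = 1 ∧ (T i).2 = (T j).2 ∧
          f = X i * X j * spechtPoly K T} := by
  obtain ⟨b, rfl⟩ : ∃ b, a = b + 1 := ⟨a - 1, by omega⟩
  subst hn
  exact map_spechtIdeal_eq_columnIdeal K (2 * (b + 1)) b
end

section
/- For n = 2a + 1, the Specht ideal I^Sp_{(a,a,1)} ⊆ K[x₁,…,xₙ] is a radical ideal, over any field K. -/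
open MvPolynomial

open Finset in
/-- The number of indices of each colour. -/
def classSize {n : ℕ} {C : Type*} [DecidableEq C] (c : Fin n → C) (k : C) : ℕ :=
  #{i | c i = k}

/-- The product of the differences `X i - X j` over all pairs `i < j` of the same colour. -/
noncomputable def colorPoly (K : Type*) [CommRing K] {n : ℕ} {C : Type*} [DecidableEq C]
    (c : Fin n → C) : MvPolynomial (Fin n) K :=
  ∏ i, ∏ j, if i < j ∧ c i = c j then X i - X j else 1

/-- The ideal generated by the polynomials `colorPoly K c` of the colourings `c` whose vector of
class sizes belongs to `S`. -/
noncomputable def colorIdeal (K : Type*) [CommRing K] (n : ℕ) {C : Type*} [DecidableEq C]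
    (S : Set (C → ℕ)) : Ideal (MvPolynomial (Fin n) K) :=
  Ideal.span {f | ∃ c : Fin n → C, classSize c ∈ S ∧ f = colorPoly K c}

/-- A set of size vectors is closed under unbalancing if it is stable under replacing two entries
by two others with the same sum and with a maximum at least as large. -/
def UnbalancingClosed {C : Type*} (S : Set (C → ℕ)) : Prop :=
  ∀ s ∈ S, ∀ (t : C → ℕ) (w z : C), w ≠ z → (∀ k, k ≠ w → k ≠ z → t k = s k) →
    t w + t z = s w + s z → s w ≤ t w → s z ≤ t w → t ∈ S

/-- The size vectors which give an element of `S` after adding one to an entry at most `d`. -/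
def derivedSizes {C : Type*} [DecidableEq C] (S : Set (C → ℕ)) (d : ℕ) : Set (C → ℕ) :=
  {s | ∃ i, s i ≤ d ∧ s + Pi.single i 1 ∈ S}

/-- No colouring with class sizes in `S` separates all the points of each fibre of `b`. -/
def NoTransversal {n : ℕ} {C : Type*} [DecidableEq C] (S : Set (C → ℕ)) (b : Fin n → ℕ) : Prop :=
  ∀ c : Fin n → C, classSize c ∈ S → ∃ i j, i ≠ j ∧ c i = c j ∧ b i = b j

/-- The polynomials vanishing on each linear subspace given by a `b` without transversals. -/
def VanishesOnBad {K : Type*} [CommRing K] {n : ℕ} {C : Type*} [DecidableEq C] (S : Set (C → ℕ))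
    (f : MvPolynomial (Fin n) K) : Prop :=
  ∀ b : Fin n → ℕ, NoTransversal S b → rename b f = 0

section Sizes

variable {C : Type*} [DecidableEq C]

theorem UnbalancingClosed.derivedSizes {S : Set (C → ℕ)} (hS : UnbalancingClosed S) (d : ℕ) :
    UnbalancingClosed (derivedSizes S d) := by
  rintro s ⟨i, hid, hi⟩ t w z hwz ht hsum hw hz
  have key : ∀ i', t i' ≤ d → ∀ s' t' : C → ℕ, s' = s + Pi.single i 1 →
      t' = t + Pi.single i' 1 → (∀ k, k ≠ w → k ≠ z → t' k = s' k) →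
      t' w + t' z = s' w + s' z →
      (s' w ≤ t' w ∧ s' z ≤ t' w ∨ s' w ≤ t' z ∧ s' z ≤ t' z) →
      t ∈ _root_.derivedSizes S d := by
    rintro i' hi' s' t' rfl rfl h1 h2 (h3 | h3)
    · exact ⟨i', hi', hS _ hi _ w z hwz h1 h2 h3.1 h3.2⟩
    · exact ⟨i', hi', hS _ hi _ z w hwz.symm (fun k hk hk' => h1 k hk' hk) (by omega) h3.2 h3.1⟩
  replace key : ∀ i', t i' ≤ d →
      (∀ k, k ≠ w → k ≠ z →
        t k + (if k = i' then 1 else 0) = s k + (if k = i then 1 else 0)) →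
      (t w + (if w = i' then 1 else 0)) + (t z + (if z = i' then 1 else 0)) =
        (s w + (if w = i then 1 else 0)) + (s z + (if z = i then 1 else 0)) →
      (s w + (if w = i then 1 else 0) ≤ t w + (if w = i' then 1 else 0) ∧
        s z + (if z = i then 1 else 0) ≤ t w + (if w = i' then 1 else 0) ∨
       s w + (if w = i then 1 else 0) ≤ t z + (if z = i' then 1 else 0) ∧
        s z + (if z = i then 1 else 0) ≤ t z + (if z = i' then 1 else 0)) →
      t ∈ _root_.derivedSizes S d := by
    intro i' hi' h1 h2 h3
    refine key i' hi' _ _ rfl rfl ?_ ?_ ?_ <;> simpa only [Pi.add_apply, Pi.single_apply]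
  by_cases hiw : i = w
  · subst hiw
    by_cases h : t i = s i
    · exact key i (by omega) (by grind) (by grind) (by grind)
    · exact key z (by omega) (by grind) (by grind) (by grind)
  by_cases hiz : i = z
  · subst hiz
    by_cases h : t w = s i
    · exact key w (by omega) (by grind) (by grind) (by grind)
    · exact key i (by omega) (by grind) (by grind) (by grind)
  · exact key i (by rw [ht i hiw hiz]; exact hid) (by grind) (by grind) (by grind)

theorem classSize_eq_sum {n : ℕ} (c : Fin n → C) (k : C) :
    classSize c k = ∑ i, if c i = k then 1 else 0 := by
  simp [classSize]

theorem classSize_update {n : ℕ} (c : Fin n → C) (a : Fin n) (q : C) :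
    classSize (Function.update c a q) + Pi.single (c a) 1 = classSize c + Pi.single q 1 := by
  funext k
  simp only [Pi.add_apply, classSize_eq_sum, Pi.single_apply]
  rw [← Finset.add_sum_erase _ _ (Finset.mem_univ a),
    ← Finset.add_sum_erase _ _ (Finset.mem_univ a)]
  have : ∑ x ∈ Finset.univ.erase a, (if Function.update c a q x = k then 1 else 0) =
      ∑ x ∈ Finset.univ.erase a, (if c x = k then 1 else 0) := by
    refine Finset.sum_congr rfl fun x hx => ?_
    rw [Function.update_of_ne (Finset.ne_of_mem_erase hx)]
  rw [this, Function.update_self]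
  grind

theorem classSize_cons {n : ℕ} (c : Fin n → C) (i : C) :
    classSize (Fin.cons i c : Fin (n + 1) → C) = classSize c + Pi.single i 1 := by
  funext k
  simp only [Pi.add_apply, classSize_eq_sum, Pi.single_apply, Fin.sum_univ_succ, Fin.cons_zero,
    Fin.cons_succ]
  grind

theorem classSize_comp_equiv {n : ℕ} (c : Fin n → C) (e : Equiv.Perm (Fin n)) :
    classSize (c ∘ e) = classSize c := by
  funext k
  simp only [classSize_eq_sum, Function.comp]
  exact Equiv.sum_comp e (fun i => if c i = k then 1 else 0)

theorem exists_largest_values (f : ℕ → ℕ) (N : ℕ) (hf : ∀ x, f x ≤ N) (m : ℕ) :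
    ∃ V : Finset ℕ, V.card = m ∧ ∀ v ∈ V, ∀ u ∉ V, f u ≤ f v := by
  induction m with
  | zero => exact ⟨∅, by simp⟩
  | succ m ih =>
    obtain ⟨V, hV, h⟩ := ih
    obtain ⟨x, hx, hmax⟩ : ∃ x ∉ V, ∀ u ∉ V, f u ≤ f x := by
      obtain ⟨x₀, hx₀⟩ := Infinite.exists_notMem_finset V
      by_contra! hcon
      have : ∀ k, ∃ x ∉ V, k ≤ f x := by
        intro k
        induction k with
        | zero => exact ⟨x₀, hx₀, by omega⟩
        | succ k ih =>
          obtain ⟨x, hx, hk⟩ := ih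
          obtain ⟨u, hu, hlt⟩ := hcon x hx
          exact ⟨u, hu, by omega⟩
      obtain ⟨x, -, hx⟩ := this (N + 1)
      have := hf x
      omega
    refine ⟨insert x V, by simp [hx, hV], ?_⟩
    intro v hv u hu
    rw [Finset.mem_insert, not_or] at hu
    rcases Finset.mem_insert.1 hv with rfl | hv
    · exact hmax u hu.2
    · exact h v hv u hu.2

/-- If `b` has no transversal of derived sizes, then putting a new index in one of the `d + 1`
largest fibres of `b` leaves no transversal with sizes in `S`. -/
theorem NoTransversal.cons_of_largest {n : ℕ} {S : Set (C → ℕ)} (hS : UnbalancingClosed S) {d : ℕ}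
    {b : Fin n → ℕ} (hb : NoTransversal (derivedSizes S d) b) {V : Finset ℕ}
    (hVcard : V.card = d + 1)
    (hV : ∀ v ∈ V, ∀ u ∉ V, classSize b u ≤ classSize b v) {v : ℕ} (hv : v ∈ V) :
    NoTransversal S (Fin.cons v b : Fin (n + 1) → ℕ) := by
  set b' : Fin (n + 1) → ℕ := Fin.cons v b with hb'
  by_contra hcon
  simp only [NoTransversal, not_forall, not_exists, not_and] at hcon
  obtain ⟨c₀, hc₀S, hc₀⟩ := hcon
  suffices H : ∀ m, ∀ c : Fin (n + 1) → C, classSize c (c 0) = m → classSize c ∈ S →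
      (∀ i j, i ≠ j → c i = c j → ¬ b' i = b' j) → False from H _ c₀ rfl hc₀S hc₀
  intro m
  induction m using Nat.strong_induction_on with
  | _ m ih =>
  intro c hm hcS hc
  by_cases hle : m ≤ d + 1
  · have hcons : c = Fin.cons (c 0) (Fin.tail c) := (Fin.cons_self_tail c).symm
    have hsz : classSize c = classSize (Fin.tail c) + Pi.single (c 0) 1 := by
      conv_lhs => rw [hcons]
      exact classSize_cons _ _
    obtain ⟨i, j, hij, h1, h2⟩ := hb (Fin.tail c) ⟨c 0, by
      have := congrFun hsz (c 0)
      simp at this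
      omega, by rw [← hsz]; exact hcS⟩
    exact hc i.succ j.succ (by simpa using hij) h1 (by simpa [hb'] using h2)
  · obtain ⟨x, hx0, hxV⟩ : ∃ x, c x = c 0 ∧ b' x ∉ V := by
      by_contra! hcon
      have : classSize c (c 0) ≤ V.card := by
        refine Finset.card_le_card_of_injOn b' (fun x hx => hcon x (by simpa using hx)) ?_
        intro x hx y hy hxy
        by_contra hne
        simp at hx hy
        exact hc x y hne (hx.trans hy.symm) hxy
      omega
    have hb'0 : b' 0 = v := rfl
    have hx00 : x ≠ 0 := by rintro rfl; exact hxV hv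
    have huv : b' x ≠ v := fun h => hxV (h ▸ hv)
    have hlt : classSize b' (b' x) < classSize b' v := by
      have := hV v hv _ hxV
      rw [hb', classSize_cons, ← hb']
      simp [huv]
      omega
    obtain ⟨y, hyv, hy⟩ : ∃ y, b' y = v ∧ ∀ i, b' i = b' x → c i ≠ c y := by
      by_contra! hcon
      choose g hg hg' using hcon
      have : classSize b' v ≤ classSize b' (b' x) := by
        refine Finset.card_le_card_of_forall_subsingleton (fun y i => c i = c y) ?_ ?_
        · intro y hy
          simp at hy
          exact ⟨g y hy, by simpa using hg y hy, hg' y hy⟩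
        · intro i _ y hy y' hy'
          simp at hy hy'
          by_contra hne
          exact hc y y' hne (hy.2.symm.trans hy'.2) (hy.1.trans hy'.1.symm)
      omega
    have hcy : c y ≠ c 0 := fun h => hy x rfl (hx0.trans h.symm)
    have hxy : x ≠ y := by rintro rfl; exact hcy hx0
    have hmin : classSize c (c 0) ≤ classSize c (c y) := by
      by_contra! hlt'
      refine ih (classSize c (c y)) (by omega) (c ∘ Equiv.swap 0 y) ?_ ?_ ?_
      · simp [classSize_comp_equiv]
      · rwa [classSize_comp_equiv]
      · have hbs : ∀ i, b' (Equiv.swap 0 y i) = b' i := by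
          intro i
          rw [Equiv.swap_apply_def]
          split_ifs with h1 h2
          · rw [h1, hyv, hb'0]
          · rw [h2, hyv, hb'0]
          · rfl
        intro i j hij h1 h2
        exact hc _ _ ((Equiv.swap 0 y).injective.ne hij) h1 (by rw [hbs, hbs, h2])
    have hup := classSize_update c x (c y)
    have hupk := fun k => congrFun hup k
    simp only [Pi.add_apply, Pi.single_apply, hx0] at hupk
    have h0 := hupk (c 0)
    have hyy := hupk (c y)
    simp only [if_true, if_neg hcy, if_neg hcy.symm] at h0 hyy
    refine ih (m - 1) (by omega) (Function.update c x (c y)) ?_ ?_ ?_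
    · rw [Function.update_of_ne hx00.symm]
      omega
    · refine hS _ hcS _ (c y) (c 0) hcy (fun k hk hk' => ?_) (by omega) (by omega) (by omega)
      have := hupk k
      simpa [hk, hk'] using this
    · intro i j hij h1 h2
      by_cases hix : i = x
      · subst hix
        rw [Function.update_self, Function.update_of_ne hij.symm] at h1
        exact hy j h2.symm h1.symm
      by_cases hjx : j = x
      · subst hjx
        rw [Function.update_self, Function.update_of_ne hij] at h1
        exact hy i h2 h1
      rw [Function.update_of_ne hix, Function.update_of_ne hjx] at h1
      exact hc i j hij h1 h2

end Sizes

section Vanishing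

variable {K : Type*} {C : Type*} [DecidableEq C]

theorem finSuccEquiv_colorPoly_cons [CommRing K] {n : ℕ} (c : Fin n → C) (i : C) :
    finSuccEquiv K n (colorPoly K (Fin.cons i c : Fin (n + 1) → C)) =
      (∏ j, if i = c j then Polynomial.X - Polynomial.C (X j) else 1) *
        Polynomial.C (colorPoly K c) := by
  simp only [colorPoly, Fin.prod_univ_succ, map_mul, map_prod, Fin.cons_zero, Fin.cons_succ,
    false_and, if_false, one_mul, Fin.succ_pos, true_and, Fin.not_lt_zero,
    Fin.succ_lt_succ_iff]
  simp only [apply_ite, map_sub, map_one, finSuccEquiv_X_zero, finSuccEquiv_X_succ]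

theorem eval_map_finSuccEquiv [CommRing K] {n : ℕ} (f : MvPolynomial (Fin (n + 1)) K)
    (b : Fin n → ℕ) (v : ℕ) :
    (((finSuccEquiv K n f).map (rename b : _ →ₐ[K] MvPolynomial ℕ K).toRingHom).eval (X v)) =
      rename (Fin.cons v b : Fin (n + 1) → ℕ) f := by
  induction f using MvPolynomial.induction_on with
  | C a => simp [finSuccEquiv_apply]
  | add p q hp hq => simp only [map_add, Polynomial.map_add, Polynomial.eval_add, hp, hq]
  | mul_X p i hp =>
    simp only [map_mul, Polynomial.map_mul, Polynomial.eval_mul, hp]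
    congr 1
    refine Fin.cases ?_ (fun j => ?_) i
    · simp [finSuccEquiv_X_zero]
    · simp [finSuccEquiv_X_succ]

theorem rename_colorPoly_eq_zero [CommRing K] {n : ℕ} (c : Fin n → C) (b : Fin n → ℕ)
    {i j : Fin n} (hij : i ≠ j) (hc : c i = c j) (hb : b i = b j) :
    rename b (colorPoly K c) = 0 := by
  wlog hlt : i < j generalizing i j
  · exact this hij.symm hc.symm hb.symm (lt_of_le_of_ne (not_lt.1 hlt) hij.symm)
  rw [colorPoly, map_prod]
  refine Finset.prod_eq_zero (Finset.mem_univ i) ?_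
  rw [map_prod]
  refine Finset.prod_eq_zero (Finset.mem_univ j) ?_
  rw [if_pos ⟨hlt, hc⟩]
  simp [hb]

theorem vanishesOnBad_of_mem_colorIdeal [CommRing K] {n : ℕ} {S : Set (C → ℕ)}
    {f : MvPolynomial (Fin n) K} (hf : f ∈ colorIdeal K n S) : VanishesOnBad S f := by
  intro b hb
  have : colorIdeal K n S ≤ RingHom.ker (rename b : _ →ₐ[K] MvPolynomial ℕ K) := by
    refine Ideal.span_le.2 ?_
    rintro _ ⟨c, hc, rfl⟩
    obtain ⟨i, j, hij, h1, h2⟩ := hb c hc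
    exact rename_colorPoly_eq_zero c b hij h1 h2
  exact this hf

/-- Every element of the ideal of derived sizes is the coefficient of degree `d` of an element
of degree at most `d` of the original ideal. -/
theorem exists_lift_of_mem_colorIdeal_derivedSizes [CommRing K] [Nontrivial K] {n : ℕ}
    {S : Set (C → ℕ)} {d : ℕ}
    {g : MvPolynomial (Fin n) K} (hg : g ∈ colorIdeal K n (derivedSizes S d)) :
    ∃ F ∈ colorIdeal K (n + 1) S, (finSuccEquiv K n F).natDegree ≤ d ∧
      (finSuccEquiv K n F).coeff d = g := by
  induction hg using Submodule.span_induction with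
  | mem g hg =>
    obtain ⟨c, ⟨i, hid, hi⟩, rfl⟩ := hg
    set P : Polynomial (MvPolynomial (Fin n) K) :=
      ∏ j, if i = c j then Polynomial.X - Polynomial.C (X j) else 1 with hP
    have hmonic : P.Monic := by
      refine Polynomial.monic_prod_of_monic _ _ fun j _ => ?_
      split_ifs
      exacts [Polynomial.monic_X_sub_C _, Polynomial.monic_one]
    have hdeg : P.natDegree = classSize c i := by
      rw [hP, Polynomial.natDegree_prod_of_monic, classSize_eq_sum]
      · refine Finset.sum_congr rfl fun j _ => ?_
        by_cases h : i = c j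
        · simp [h]
        · simp [h, Ne.symm h]
      · intro j _
        split_ifs
        exacts [Polynomial.monic_X_sub_C _, Polynomial.monic_one]
    have hmonic' : (Polynomial.X ^ (d - classSize c i) * P).Monic :=
      (Polynomial.monic_X_pow _).mul hmonic
    have hdeg' : (Polynomial.X ^ (d - classSize c i) * P).natDegree = d := by
      rw [(Polynomial.monic_X_pow _).natDegree_mul hmonic, hdeg, Polynomial.natDegree_X_pow]
      omega
    have hF : finSuccEquiv K n (X 0 ^ (d - classSize c i) * colorPoly K (Fin.cons i c)) =
        (Polynomial.X ^ (d - classSize c i) * P) * Polynomial.C (colorPoly K c) := by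
      rw [map_mul, map_pow, finSuccEquiv_X_zero, finSuccEquiv_colorPoly_cons, mul_assoc]
    refine ⟨X 0 ^ (d - classSize c i) * colorPoly K (Fin.cons i c),
      Ideal.mul_mem_left _ _ (Ideal.subset_span ⟨_, ?_, rfl⟩), ?_, ?_⟩
    · rwa [classSize_cons]
    · rw [hF]
      exact (Polynomial.natDegree_mul_C_le _ _).trans hdeg'.le
    · rw [hF, Polynomial.coeff_mul_C]
      have := hmonic'.coeff_natDegree
      rw [hdeg'] at this
      rw [this, one_mul]
  | zero => exact ⟨0, Ideal.zero_mem _, by simp⟩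
  | add x y _ _ hx hy =>
    obtain ⟨F, hF, hFd, hFc⟩ := hx
    obtain ⟨G, hG, hGd, hGc⟩ := hy
    refine ⟨F + G, Ideal.add_mem _ hF hG, ?_, by simp [hFc, hGc]⟩
    rw [map_add]
    exact (Polynomial.natDegree_add_le _ _).trans (max_le hFd hGd)
  | smul h x _ hx =>
    obtain ⟨F, hF, hFd, hFc⟩ := hx
    have hh : finSuccEquiv K n (rename Fin.succ h) = Polynomial.C h := by
      induction h using MvPolynomial.induction_on with
      | C a => simp [finSuccEquiv_apply]
      | add p q hp hq => simp [hp, hq]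
      | mul_X p i hp => simp [hp, finSuccEquiv_X_succ]
    refine ⟨rename Fin.succ h * F, Ideal.mul_mem_left _ _ hF, ?_, ?_⟩
    · rw [map_mul, hh]
      exact (Polynomial.natDegree_C_mul_le _ _).trans hFd
    · rw [map_mul, hh, Polynomial.coeff_C_mul, hFc, smul_eq_mul]

theorem VanishesOnBad.coeff_finSuccEquiv [CommRing K] [IsDomain K] {n : ℕ} {S : Set (C → ℕ)}
    (hS : UnbalancingClosed S) {f : MvPolynomial (Fin (n + 1)) K} (hf : VanishesOnBad S f) {d : ℕ}
    (hd : (finSuccEquiv K n f).natDegree ≤ d) :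
    VanishesOnBad (derivedSizes S d) ((finSuccEquiv K n f).coeff d) := by
  intro b hb
  obtain ⟨V, hVcard, hV⟩ := exists_largest_values (classSize b) n
    (fun x => (Finset.card_le_univ _).trans (by simp)) (d + 1)
  have hp : (finSuccEquiv K n f).map (rename b : _ →ₐ[K] MvPolynomial ℕ K).toRingHom = 0 := by
    refine Polynomial.eq_zero_of_natDegree_lt_card_of_eval_eq_zero' _
      (V.map ⟨X, X_injective⟩) ?_ ?_
    · intro x hx
      obtain ⟨v, hv, rfl⟩ := Finset.mem_map.1 hx
      refine (eval_map_finSuccEquiv f b v).trans (hf _ ?_)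
      exact hb.cons_of_largest hS hVcard hV hv
    · rw [Finset.card_map, hVcard]
      exact Nat.lt_succ_of_le (Polynomial.natDegree_map_le.trans hd)
  have := congrArg (fun p => Polynomial.coeff p d) hp
  simpa [Polynomial.coeff_map] using this

/-- A polynomial vanishing on all the subspaces without transversals lies in the ideal generated
by the colouring polynomials. -/
theorem VanishesOnBad.mem_colorIdeal [CommRing K] [IsDomain K] {n : ℕ} {S : Set (C → ℕ)}
    (hS : UnbalancingClosed S) {f : MvPolynomial (Fin n) K} (hf : VanishesOnBad S f) :
    f ∈ colorIdeal K n S := by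
  induction n generalizing S with
  | zero =>
    by_cases h : classSize (Fin.elim0 : Fin 0 → C) ∈ S
    · have h1 : (1 : MvPolynomial (Fin 0) K) ∈ colorIdeal K 0 S :=
        Ideal.subset_span ⟨_, h, by simp [colorPoly]⟩
      rw [(Ideal.eq_top_iff_one _).2 h1]
      trivial
    · have hinj := rename_injective (R := K) (Fin.elim0 : Fin 0 → ℕ) (fun i => i.elim0)
      have : f = 0 := by
        refine hinj ?_
        rw [map_zero]
        refine hf _ fun c hc => (h ?_).elim
        rwa [Subsingleton.elim Fin.elim0 c]
      rw [this]
      exact Ideal.zero_mem _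
  | succ n ih =>
    obtain ⟨D, hD⟩ : ∃ D, (finSuccEquiv K n f).degree < (D : ℕ) :=
      ⟨(finSuccEquiv K n f).natDegree + 1,
        Polynomial.degree_le_natDegree.trans_lt (by exact_mod_cast Nat.lt_succ_self _)⟩
    induction D generalizing f with
    | zero =>
      have : finSuccEquiv K n f = 0 := by
        rw [← Polynomial.degree_eq_bot]
        exact Nat.WithBot.lt_zero_iff.1 hD
      rw [(map_eq_zero_iff _ (finSuccEquiv K n).injective).1 this]
      exact Ideal.zero_mem _
    | succ d ihd =>
      have hd : (finSuccEquiv K n f).natDegree ≤ d :=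
        Polynomial.natDegree_le_iff_degree_le.2 (Order.lt_succ_iff.1 (by exact_mod_cast hD))
      obtain ⟨F, hF, hFd, hFc⟩ := exists_lift_of_mem_colorIdeal_derivedSizes
        (ih (hS.derivedSizes d) (hf.coeff_finSuccEquiv hS hd))
      have hsub : f - F ∈ colorIdeal K (n + 1) S := by
        refine ihd ?_ ?_
        · intro b hb
          rw [map_sub, hf b hb, vanishesOnBad_of_mem_colorIdeal hF b hb, sub_zero]
        · rw [Polynomial.degree_lt_iff_coeff_zero]
          intro m hm
          rw [map_sub, Polynomial.coeff_sub]
          rcases hm.eq_or_lt with rfl | hm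
          · rw [hFc, sub_self]
          · rw [Polynomial.coeff_eq_zero_of_natDegree_lt (hd.trans_lt hm),
              Polynomial.coeff_eq_zero_of_natDegree_lt (hFd.trans_lt hm), sub_zero]
      simpa using Ideal.add_mem _ hsub hF

end Vanishing

section Straightening

variable {K : Type*} [Field K] {C : Type*} [DecidableEq C]

theorem prod_prod_eq_prod_lt {M : Type*} [CommMonoid M] {n : ℕ} (E : Fin n → Fin n → M)
    (hE : ∀ i, E i i = 1) :
    ∏ i, ∏ j, E i j = ∏ i, ∏ j, if i < j then E i j * E j i else 1 := by
  have h1 : ∀ i j, E i j = (if i < j then E i j else 1) * (if j < i then E i j else 1) := by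
    intro i j
    rcases lt_trichotomy i j with h | rfl | h
    · simp [h, h.not_gt]
    · simp [hE]
    · simp [h, h.not_gt]
  have h2 : ∀ i j, (if i < j then E i j * E j i else 1) =
      (if i < j then E i j else 1) * (if i < j then E j i else 1) := by
    intro i j
    split_ifs <;> simp
  simp only [h2, Finset.prod_mul_distrib]
  rw [Finset.prod_comm (f := fun i j : Fin n => if i < j then E j i else 1), ← Finset.prod_mul_distrib]
  refine Finset.prod_congr rfl fun i _ => ?_
  rw [← Finset.prod_mul_distrib]
  exact Finset.prod_congr rfl fun j _ => h1 i j

/-- A product of differences over pairs of indices of the same colour, each unordered pair being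
taken in one order, is `colorPoly` up to sign. -/
theorem associated_colorPoly {n : ℕ} (c : Fin n → C) (r : Fin n → Fin n → Prop)
    [DecidableRel r] (hirr : ∀ i, ¬ r i i) (hasymm : ∀ i j, r i j → ¬ r j i)
    (hr : ∀ i j, i ≠ j → (c i = c j ↔ r i j ∨ r j i)) :
    Associated (∏ i, ∏ j, if r i j then (X i - X j : MvPolynomial (Fin n) K) else 1)
      (colorPoly K c) := by
  rw [prod_prod_eq_prod_lt _ (fun i => if_neg (hirr i)), colorPoly]
  refine Associated.prod _ _ _ fun i _ => Associated.prod _ _ _ fun j _ => ?_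
  by_cases hij : i < j
  · have h := hr i j hij.ne
    by_cases h1 : r i j
    · simp [hij, h1, hasymm i j h1, h.2 (Or.inl h1)]
    by_cases h2 : r j i
    · simp only [hij, h1, h2, h.2 (Or.inr h2), if_true, if_false, one_mul, and_self]
      rw [← neg_sub]
      exact (Associated.refl _).neg_left
    · simp [hij, h1, h2, h]
  · simp [hij]

/-- The part of `colorPoly` not involving the variable `X a`. -/
noncomputable def colorPolyErase (K : Type*) [CommRing K] {n : ℕ} (c : Fin n → C) (a : Fin n) :
    MvPolynomial (Fin n) K :=
  ∏ i ∈ Finset.univ.erase a, ∏ j ∈ Finset.univ.erase a,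
    if i < j ∧ c i = c j then X i - X j else 1

theorem associated_colorPoly_erase {n : ℕ} (c : Fin n → C) (a : Fin n) :
    Associated (colorPoly K c)
      ((∏ j ∈ (Finset.univ.filter fun j => c j = c a).erase a, (X a - X j)) *
        colorPolyErase K c a) := by
  have h1 : colorPoly K c = (∏ j ∈ Finset.univ.erase a,
      ((if a < j ∧ c a = c j then X a - X j else 1) *
        (if j < a ∧ c j = c a then X j - X a else 1))) * colorPolyErase K c a := by
    have hinner : ∀ i, (∏ j, if i < j ∧ c i = c j then (X i - X j : MvPolynomial (Fin n) K) else 1)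
        = (if i < a ∧ c i = c a then X i - X a else 1) *
          ∏ j ∈ Finset.univ.erase a, if i < j ∧ c i = c j then X i - X j else 1 :=
      fun i => (Finset.mul_prod_erase _ _ (Finset.mem_univ a)).symm
    rw [colorPoly, ← Finset.mul_prod_erase _ _ (Finset.mem_univ a)]
    simp only [hinner, lt_irrefl, false_and, if_false, one_mul, Finset.prod_mul_distrib,
      colorPolyErase, mul_assoc]
  have h2 : (Finset.univ.filter fun j => c j = c a).erase a =
      (Finset.univ.erase a).filter fun j => c j = c a := by
    ext j
    simp [and_comm]
  rw [h1, h2, Finset.prod_filter]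
  refine Associated.mul_right (Associated.prod _ _ _ fun j hj => ?_) _
  rcases (Finset.ne_of_mem_erase hj).lt_or_gt with h | h
  · by_cases hc : c j = c a
    · simp only [h, h.not_gt, hc, and_self, false_and, if_true, if_false, one_mul]
      rw [← neg_sub]
      exact (Associated.refl _).neg_left
    · simp [hc, Ne.symm hc]
  · by_cases hc : c j = c a
    · simp [h, h.not_gt, hc]
    · simp [hc, Ne.symm hc]

theorem colorPolyErase_update {n : ℕ} (c : Fin n → C) (a : Fin n) (q : C) :
    colorPolyErase K (Function.update c a q) a = colorPolyErase K c a := by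
  refine Finset.prod_congr rfl fun i hi => Finset.prod_congr rfl fun j hj => ?_
  rw [Function.update_of_ne (Finset.ne_of_mem_erase hi),
    Function.update_of_ne (Finset.ne_of_mem_erase hj)]

theorem associated_colorPoly_update {n : ℕ} (c : Fin n → C) (a : Fin n) {q : C} (hq : q ≠ c a) :
    Associated
      (colorPoly K c * ∏ j ∈ Finset.univ.filter (fun j => c j = q), (X a - X j))
      (colorPoly K (Function.update c a q) *
        ∏ j ∈ (Finset.univ.filter fun j => c j = c a).erase a, (X a - X j)) := by
  have h1 := associated_colorPoly_erase (K := K) c a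
  have h2 := associated_colorPoly_erase (K := K) (Function.update c a q) a
  have h3 : ((Finset.univ.filter fun j =>
      Function.update c a q j = Function.update c a q a).erase a) =
      Finset.univ.filter (fun j => c j = q) := by
    ext j
    by_cases h : j = a
    · subst h
      simp [hq.symm]
    · simp [h]
  rw [h3, colorPolyErase_update] at h2
  refine (h1.mul_right _).trans (Associated.trans ?_ (h2.mul_right _).symm)
  exact Associated.of_eq (by ring)

/-- A colouring polynomial with two classes whose sizes differ by at least two is a combination of
those obtained by moving one index from the larger class to the smaller one. -/
theorem colorPoly_mem_of_move {n : ℕ} (c : Fin n → C) {p q : C}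
    (hpq : classSize c q + 2 ≤ classSize c p) (I : Ideal (MvPolynomial (Fin n) K))
    (hI : ∀ a, c a = p → colorPoly K (Function.update c a q) ∈ I) :
    colorPoly K c ∈ I := by
  have hne : q ≠ p := by rintro rfl; omega
  let F := FractionRing (MvPolynomial (Fin n) K)
  let φ : MvPolynomial (Fin n) K →+* F := algebraMap _ _
  have hφ : Function.Injective φ := IsFractionRing.injective _ _
  have hv : Function.Injective (fun i : Fin n => φ (X i)) := hφ.comp (X_injective)
  set A : Finset (Fin n) := Finset.univ.filter fun j => c j = p with hA
  set B : Finset (Fin n) := Finset.univ.filter fun j => c j = q with hB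
  set m := classSize c p - 1 - classSize c q with hm
  have hAc : A.card = classSize c p := rfl
  have hBc : B.card = classSize c q := rfl
  let P : Polynomial F := Polynomial.X ^ m * ∏ j ∈ B, (Polynomial.X - Polynomial.C (φ (X j)))
  have hmon : (∏ j ∈ B, (Polynomial.X - Polynomial.C (φ (X j)))).Monic :=
    Polynomial.monic_prod_of_monic _ _ fun j _ => Polynomial.monic_X_sub_C _
  have hPmon : P.Monic := (Polynomial.monic_X_pow _).mul hmon
  have hPdeg : P.natDegree = A.card - 1 := by
    rw [(Polynomial.monic_X_pow _).natDegree_mul hmon, Polynomial.natDegree_X_pow,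
      Polynomial.natDegree_prod_of_monic _ _ fun j _ => Polynomial.monic_X_sub_C _]
    simp only [Polynomial.natDegree_X_sub_C, Finset.sum_const, smul_eq_mul, mul_one]
    omega
  have hone : (1 : F) = ∑ i ∈ A, P.eval (φ (X i)) / ∏ j ∈ A.erase i, (φ (X i) - φ (X j)) := by
    rw [← Lagrange.coeff_eq_sum (hv.injOn) (P := P)]
    · rw [← hPdeg]
      exact hPmon.coeff_natDegree.symm
    · rw [Polynomial.degree_eq_natDegree hPmon.ne_zero, hPdeg]
      exact_mod_cast (by omega : A.card - 1 < A.card)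
  have hu : ∀ a, ∃ u : MvPolynomial (Fin n) K, c a = p →
      colorPoly K c * ∏ j ∈ B, (X a - X j) =
        u * colorPoly K (Function.update c a q) * ∏ j ∈ A.erase a, (X a - X j) := by
    intro a
    by_cases ha : c a = p
    · obtain ⟨u, hu⟩ := (associated_colorPoly_update (K := K) c a (ha ▸ hne)).symm
      refine ⟨u, fun _ => ?_⟩
      rw [hA, ← ha, hB, ← hu]
      ring
    · exact ⟨0, fun h => (ha h).elim⟩
  choose u hu using hu
  have hsum : colorPoly K c =
      ∑ a ∈ A, X a ^ m * u a * colorPoly K (Function.update c a q) := by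
    apply hφ
    rw [← mul_one (φ (colorPoly K c)), hone, Finset.mul_sum, map_sum]
    refine Finset.sum_congr rfl fun a ha => ?_
    have hD : ∏ j ∈ A.erase a, (φ (X a) - φ (X j)) ≠ 0 := by
      refine Finset.prod_ne_zero_iff.2 fun j hj => sub_ne_zero.2 fun h => ?_
      exact Finset.ne_of_mem_erase hj (hv h).symm
    have h := congrArg φ (hu a (by simpa [hA] using ha))
    simp only [map_mul, map_prod, map_sub] at h
    rw [mul_div_assoc', div_eq_iff hD]
    simp only [P, Polynomial.eval_mul, Polynomial.eval_pow, Polynomial.eval_X,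
      Polynomial.eval_prod, Polynomial.eval_sub, Polynomial.eval_C, map_mul, map_pow]
    linear_combination (φ (X a)) ^ m * h
  rw [hsum]
  exact Ideal.sum_mem _ fun a ha => Ideal.mul_mem_left _ _ (hI a (by simpa [hA] using ha))

/-- An ideal containing the polynomials of all balanced colourings contains those of all
colourings. -/
theorem colorPoly_mem_of_balanced [Fintype C] {n : ℕ} (I : Ideal (MvPolynomial (Fin n) K))
    (hI : ∀ c : Fin n → C, (∀ p q, classSize c p ≤ classSize c q + 1) → colorPoly K c ∈ I)
    (c : Fin n → C) : colorPoly K c ∈ I := by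
  induction hN : ∑ k, classSize c k ^ 2 using Nat.strong_induction_on generalizing c with
  | _ N ih =>
  by_cases hbal : ∀ p q, classSize c p ≤ classSize c q + 1
  · exact hI c hbal
  push Not at hbal
  obtain ⟨p, q, hpq⟩ := hbal
  have hne : p ≠ q := by rintro rfl; omega
  refine colorPoly_mem_of_move c (p := p) (q := q) (by omega) I fun a ha => ih _ ?_ _ rfl
  have hupk := fun k => congrFun (classSize_update c a q) k
  simp only [Pi.add_apply, Pi.single_apply, ha] at hupk
  have hp := hupk p
  have hq := hupk q
  simp only [if_true, if_neg hne, if_neg hne.symm] at hp hq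
  have hqe : q ∈ Finset.univ.erase p := by simp [hne.symm]
  rw [← hN, ← Finset.add_sum_erase _ _ (Finset.mem_univ p), ← Finset.add_sum_erase _ _ hqe,
    ← Finset.add_sum_erase _ _ (Finset.mem_univ p), ← Finset.add_sum_erase _ _ hqe]
  have hrest : ∑ x ∈ (Finset.univ.erase p).erase q, classSize (Function.update c a q) x ^ 2 =
      ∑ x ∈ (Finset.univ.erase p).erase q, classSize c x ^ 2 := by
    refine Finset.sum_congr rfl fun x hx => ?_
    simp only [Finset.mem_erase] at hx
    have := hupk x
    simp only [if_neg hx.1, if_neg hx.2.1, add_zero] at this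
    rw [this]
  rw [hrest]
  have hp' : classSize c p = classSize (Function.update c a q) p + 1 := by omega
  have hq' : classSize (Function.update c a q) q = classSize c q + 1 := by omega
  rw [hp', hq']
  nlinarith

end Straightening

section Tableaux

variable {K : Type*} [Field K]

theorem associated_spechtPoly {n : ℕ} {C : Type*} [DecidableEq C] {T : Fin n → ℕ × ℕ}
    (hT : Function.Injective T) (c : Fin n → C) (hc : ∀ i j, c i = c j ↔ (T i).2 = (T j).2) :
    Associated (spechtPoly K T) (colorPoly K c) := by
  have h := associated_colorPoly (K := K) c
    (fun i j => (T i).2 = (T j).2 ∧ (T i).1 < (T j).1) (by simp)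
    (fun i j h h' => by omega) (fun i j hij => by
      have : T i ≠ T j := hT.ne hij
      rw [hc, Ne, Prod.ext_iff] at *
      omega)
  rwa [← Fintype.prod_prod_type', ← Finset.prod_filter] at h

/-- The classes of a colouring with one class of size three and all others of size two are the
columns of a tableau of shape `(a, a, 1)`. -/
theorem exists_tableau_of_classSize {n a : ℕ} (ha : 1 ≤ a) (c : Fin n → Fin a) (k₀ : Fin a)
    (h₀ : classSize c k₀ = 3) (h : ∀ k, k ≠ k₀ → classSize c k = 2) :
    ∃ T : Fin n → ℕ × ℕ, IsTableau [a, a, 1] T ∧ ∀ i j, c i = c j ↔ (T i).2 = (T j).2 := by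
  let σ : Equiv.Perm (Fin a) := Equiv.swap k₀ ⟨0, ha⟩
  let r : Fin n → ℕ := fun i => (Finset.univ.filter fun j => j < i ∧ c j = c i).card
  have hσ : ∀ k, (σ k : ℕ) = 0 ↔ k = k₀ := by
    intro k
    have : σ k₀ = ⟨0, ha⟩ := Equiv.swap_apply_left _ _
    constructor
    · intro hk
      exact σ.injective (this ▸ Fin.ext hk)
    · rintro rfl
      rw [this]
  have hr : ∀ i j, c i = c j → i < j → r i < r j := by
    intro i j hc hij
    refine Finset.card_lt_card (Finset.ssubset_iff_of_subset ?_ |>.2 ⟨i, ?_, ?_⟩)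
    · intro k hk
      simp at hk ⊢
      exact ⟨hk.1.trans hij, hk.2.trans hc⟩
    · simp [hij, hc]
    · simp
  have hrlt : ∀ i, r i < classSize c (c i) := by
    intro i
    refine Finset.card_lt_card (Finset.ssubset_iff_of_subset ?_ |>.2 ⟨i, ?_, ?_⟩)
    · intro k hk
      simp at hk ⊢
      exact hk.2
    · simp
    · simp
  have hrinj : ∀ i j, c i = c j → r i = r j → i = j := by
    intro i j hc hij
    rcases lt_trichotomy i j with hlt | rfl | hlt
    · exact absurd hij (hr i j hc hlt).ne
    · rfl
    · exact absurd hij (hr j i hc.symm hlt).ne'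
  have hsurj : ∀ k : Fin a, ∀ m < classSize c k, ∃ i, c i = k ∧ r i = m := by
    intro k m hm
    have himg : (Finset.univ.filter fun i => c i = k).image r =
        Finset.range (classSize c k) := by
      refine Finset.eq_of_subset_of_card_le ?_ ?_
      · intro x hx
        obtain ⟨i, hi, rfl⟩ := Finset.mem_image.1 hx
        have hi : c i = k := by simpa using hi
        exact Finset.mem_range.2 (hi ▸ hrlt i)
      · rw [Finset.card_range, Finset.card_image_of_injOn]
        · rfl
        · intro i hi j hj hij
          simp at hi hj
          exact hrinj i j (hi.trans hj.symm) hij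
    have := himg ▸ Finset.mem_range.2 hm
    obtain ⟨i, hi, rfl⟩ := Finset.mem_image.1 this
    exact ⟨i, by simpa using hi, rfl⟩
  refine ⟨fun i => (r i, σ (c i)), ⟨?_, ?_, ?_⟩, ?_⟩
  · intro i j hij
    simp only [Prod.mk.injEq] at hij
    exact hrinj i j (σ.injective (Fin.ext hij.2)) hij.1
  · intro i
    have hi := hrlt i
    have hlt := (σ (c i)).isLt
    by_cases hk : c i = k₀
    · rw [hk, h₀] at hi
      have h0 := (hσ (c i)).2 hk
      refine ⟨by simpa using hi, ?_⟩
      simp only [h0]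
      interval_cases r i <;> simp <;> omega
    · rw [h _ hk] at hi
      refine ⟨by simp; omega, ?_⟩
      interval_cases hri : r i <;> simp [hri]
  · intro x y hx hy
    have hya : y < a := by
      simp at hx
      interval_cases x <;> simp at hy <;> omega
    obtain ⟨i, hi, rfl⟩ := hsurj (σ.symm ⟨y, hya⟩) x (by
      by_cases hk : σ.symm ⟨y, hya⟩ = k₀
      · rw [hk, h₀]
        simpa using hx
      · rw [h _ hk]
        have : y ≠ 0 := fun h0 => hk ((hσ _).1 (by simpa using h0))
        simp at hx
        by_contra! h2
        obtain rfl : x = 2 := by omega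
        simp at hy
        exact this hy)
    exact ⟨i, by simp [hi]⟩
  · intro i j
    simp [← Fin.ext_iff]

theorem exists_classSize_eq_three_of_balanced {n a : ℕ} (hn : n = 2 * a + 1) (c : Fin n → Fin a)
    (hc : ∀ p q, classSize c p ≤ classSize c q + 1) :
    ∃ k₀, classSize c k₀ = 3 ∧ ∀ k, k ≠ k₀ → classSize c k = 2 := by
  have hsum : ∑ k, classSize c k = 2 * a + 1 := by
    have := Finset.card_eq_sum_card_fiberwise (s := Finset.univ) (t := Finset.univ) (f := c)
      (fun _ _ => Finset.mem_univ _)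
    rw [Finset.card_univ, Fintype.card_fin] at this
    exact this.symm.trans hn
  obtain ⟨k₀, hk₀⟩ : ∃ k, 3 ≤ classSize c k := by
    by_contra! hcon
    have : ∑ k, classSize c k ≤ ∑ _k : Fin a, 2 :=
      Finset.sum_le_sum fun k _ => by have := hcon k; omega
    simp at this
    omega
  have hrest : ∑ k : Fin a, (classSize c k - 2) = 1 := by
    have : ∑ k, classSize c k = ∑ k : Fin a, (classSize c k - 2) + ∑ _k : Fin a, 2 := by
      rw [← Finset.sum_add_distrib]
      refine Finset.sum_congr rfl fun k _ => ?_
      have := hc k₀ k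
      omega
    simp at this
    omega
  rw [← Finset.add_sum_erase _ _ (Finset.mem_univ k₀)] at hrest
  refine ⟨k₀, by omega, fun k hk => ?_⟩
  have hle := Finset.single_le_sum (f := fun k => classSize c k - 2) (fun _ _ => Nat.zero_le _)
    (Finset.mem_erase.2 ⟨hk, Finset.mem_univ k⟩)
  have := hc k₀ k
  omega

theorem spechtIdeal_eq_colorIdeal {n a : ℕ} (ha : 1 ≤ a) (hn : n = 2 * a + 1) :
    spechtIdeal K n [a, a, 1] = colorIdeal K n (Set.univ : Set (Fin a → ℕ)) := by
  refine le_antisymm (Ideal.span_le.2 ?_) (Ideal.span_le.2 ?_)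
  · rintro _ ⟨T, ⟨hinj, hT, -⟩, rfl⟩
    have hlt : ∀ i, (T i).2 < a := by
      intro i
      obtain ⟨h1, h2⟩ := hT i
      simp at h1
      interval_cases (T i).1 <;> simp at h2 <;> omega
    have h := associated_spechtPoly (K := K) hinj (fun i => (⟨(T i).2, hlt i⟩ : Fin a))
      (fun i j => by simp)
    exact Ideal.mem_of_dvd _ h.symm.dvd (Ideal.subset_span ⟨_, trivial, rfl⟩)
  · rintro _ ⟨c, -, rfl⟩
    refine colorPoly_mem_of_balanced _ (fun c hc => ?_) c
    obtain ⟨k₀, h₀, h⟩ := exists_classSize_eq_three_of_balanced hn c hc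
    obtain ⟨T, hT, hcol⟩ := exists_tableau_of_classSize ha c k₀ h₀ h
    exact Ideal.mem_of_dvd _ (associated_spechtPoly hT.1 c hcol).dvd
      (Ideal.subset_span ⟨T, hT, rfl⟩)

end Tableaux
/-- Theorem 4.5: for `n = 2a + 1`, the Specht ideal `I^Sp_{(a, a, 1)}` is a radical
ideal, over any field. -/
theorem specht_aa1_isRadical {K : Type*} [Field K] (n a : ℕ)
    (ha : 1 ≤ a) (hn : n = 2 * a + 1) :
    (spechtIdeal K n [a, a, 1]).IsRadical := by
  rw [spechtIdeal_eq_colorIdeal ha hn]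
  rintro f ⟨m, hm⟩
  refine VanishesOnBad.mem_colorIdeal (fun _ _ _ _ _ _ _ _ _ _ => trivial) fun b hb => ?_
  have h := vanishesOnBad_of_mem_colorIdeal hm b hb
  rw [map_pow] at h
  exact eq_zero_of_pow_eq_zero h
end
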